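/- arXiv:math/0508079 — 8 statements merged into one kernel-verified Lean document; each statement's English description precedes it below -/
import Mathlib

section
/- Let p be a prime and let a, b be nonzero rational numbers such that the quaternion algebra D = (a,b/ℚ) is ramified exactly at p and ∞; that is, the base changes (a,b/ℝ) and (a,b/ℚ_p) are division rings, while for every prime q ≠ p the base change (a,b/ℚ_q) is not a division ring. Let f(x) = x² + a₁x + a₂ be a monic quadratic polynomial with rational coefficients which is irreducible over ℚ_p and irreducible over ℝ. Then there exists an element α ∈ D with α² + a₁·α + a₂ = 0 (where a₁, a₂ are viewed in D via the structure map ℚ → D). -/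
open Quaternion Polynomial

/-- `w` is a norm from the quadratic algebra obtained by adjoining a square root of `u`. -/
def IsQuadNorm {F : Type*} [Field F] (u w : F) : Prop := ∃ x y : F, x ^ 2 - u * y ^ 2 = w

namespace IsQuadNorm

variable {F : Type*} [Field F] {u w w' s : F}

lemma mul (h : IsQuadNorm u w) (h' : IsQuadNorm u w') : IsQuadNorm u (w * w') := by
  obtain ⟨x, y, rfl⟩ := h
  obtain ⟨x', y', rfl⟩ := h'
  exact ⟨x * x' + u * y * y', x * y' + y * x', by ring⟩

lemma mul_sq (h : IsQuadNorm u w) (s : F) : IsQuadNorm u (w * s ^ 2) := by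
  obtain ⟨x, y, rfl⟩ := h
  exact ⟨x * s, y * s, by ring⟩

lemma mul_sq_iff (hs : s ≠ 0) : IsQuadNorm u (w * s ^ 2) ↔ IsQuadNorm u w := by
  refine ⟨fun h ↦ ?_, fun h ↦ h.mul_sq s⟩
  have := h.mul_sq s⁻¹
  rwa [mul_assoc, ← mul_pow, mul_inv_cancel₀ hs, one_pow, mul_one] at this

lemma of_mul (hw : w ≠ 0) (h : IsQuadNorm u w) (h' : IsQuadNorm u (w * w')) :
    IsQuadNorm u w' := by
  have := h.mul h'
  rw [← mul_sq_iff hw]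
  convert this using 1
  ring

lemma neg_self (u : F) : IsQuadNorm u (-u) := ⟨0, 1, by ring⟩

lemma of_sq [NeZero (2 : F)] (hs : s ≠ 0) (w : F) : IsQuadNorm (s ^ 2) w := by
  have : (2 : F) ≠ 0 := two_ne_zero
  exact ⟨(w + 1) / 2, (w - 1) / (2 * s), by field_simp; ring⟩

lemma of_isSquare [NeZero (2 : F)] (hu : u ≠ 0) (h : IsSquare u) (w : F) : IsQuadNorm u w := by
  obtain ⟨s, rfl⟩ := h
  rw [← pow_two]
  exact of_sq (by rintro rfl; simp at hu) w

lemma symm [NeZero (2 : F)] (hw : w ≠ 0) (h : IsQuadNorm u w) : IsQuadNorm w u := by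
  obtain ⟨x, y, rfl⟩ := h
  by_cases hy : y = 0
  · subst hy
    exact of_isSquare hw ⟨x, by ring⟩ u
  · exact ⟨x / y, 1 / y, by field_simp; ring⟩

lemma comm [NeZero (2 : F)] (hu : u ≠ 0) (hw : w ≠ 0) : IsQuadNorm u w ↔ IsQuadNorm w u :=
  ⟨symm hw, symm hu⟩

lemma sq_mul_left_iff (hs : s ≠ 0) : IsQuadNorm (u * s ^ 2) w ↔ IsQuadNorm u w := by
  constructor
  · rintro ⟨x, y, rfl⟩
    exact ⟨x, s * y, by ring⟩
  · rintro ⟨x, y, rfl⟩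
    exact ⟨x, y / s, by field_simp⟩

end IsQuadNorm

/-- The pure quaternions of the quaternion algebra `(a, b)` contain a square root of `d`. -/
def IsPureSquare {F : Type*} [Field F] (a b d : F) : Prop :=
  ∃ x y z : F, a * x ^ 2 + b * y ^ 2 - a * b * z ^ 2 = d

namespace IsPureSquare

variable {F : Type*} [Field F] {a b d s : F}

lemma mul_sq_iff (hs : s ≠ 0) : IsPureSquare a b (d * s ^ 2) ↔ IsPureSquare a b d := by
  constructor
  · rintro ⟨x, y, z, h⟩
    refine ⟨x / s, y / s, z / s, ?_⟩
    field_simp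
    linear_combination h
  · rintro ⟨x, y, z, rfl⟩
    exact ⟨x * s, y * s, z * s, by ring⟩

lemma left_mul_sq_iff (hs : s ≠ 0) : IsPureSquare (a * s ^ 2) b d ↔ IsPureSquare a b d := by
  constructor
  · rintro ⟨x, y, z, h⟩
    exact ⟨x * s, y, z * s, by linear_combination h⟩
  · rintro ⟨x, y, z, rfl⟩
    exact ⟨x / s, y, z / s, by field_simp⟩

lemma comm : IsPureSquare a b d ↔ IsPureSquare b a d := by
  constructor <;> rintro ⟨x, y, z, rfl⟩ <;> exact ⟨y, x, z, by ring⟩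

lemma right_mul_sq_iff (hs : s ≠ 0) : IsPureSquare a (b * s ^ 2) d ↔ IsPureSquare a b d := by
  rw [comm, left_mul_sq_iff hs, comm]

lemma neg_mul_iff (ha : a ≠ 0) : IsPureSquare a (-(a * b)) d ↔ IsPureSquare a b d := by
  constructor
  · rintro ⟨x, y, z, rfl⟩
    exact ⟨x, a * z, y, by ring⟩
  · rintro ⟨x, y, z, rfl⟩
    exact ⟨x, z, y / a, by field_simp; ring⟩

/-- An isotropic ternary form is universal. -/
lemma of_isotropic [NeZero (2 : F)] (ha : a ≠ 0) (hb : b ≠ 0) {x y z : F}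
    (h0 : a * x ^ 2 + b * y ^ 2 - a * b * z ^ 2 = 0) (h : x ≠ 0 ∨ y ≠ 0 ∨ z ≠ 0) (d : F) :
    IsPureSquare a b d := by
  have h2 : (2 : F) ≠ 0 := two_ne_zero
  rcases h with h | h | h
  · have hne : 2 * a * x ≠ 0 := by positivity
    refine ⟨(d - a) / (2 * a * x) * x + 1, (d - a) / (2 * a * x) * y,
      (d - a) / (2 * a * x) * z, ?_⟩
    generalize hk : (d - a) / (2 * a * x) = k
    rw [div_eq_iff hne] at hk
    linear_combination k ^ 2 * h0 - hk
  · have hne : 2 * b * y ≠ 0 := by positivity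
    refine ⟨(d - b) / (2 * b * y) * x, (d - b) / (2 * b * y) * y + 1,
      (d - b) / (2 * b * y) * z, ?_⟩
    generalize hk : (d - b) / (2 * b * y) = k
    rw [div_eq_iff hne] at hk
    linear_combination k ^ 2 * h0 - hk
  · have hne : 2 * (a * b) * z ≠ 0 := by positivity
    refine ⟨(-d - a * b) / (2 * (a * b) * z) * x, (-d - a * b) / (2 * (a * b) * z) * y,
      (-d - a * b) / (2 * (a * b) * z) * z + 1, ?_⟩
    generalize hk : (-d - a * b) / (2 * (a * b) * z) = k
    rw [div_eq_iff hne] at hk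
    linear_combination k ^ 2 * h0 + hk

/-- A common value of the two binary forms into which `⟨a, b, -ab, -d⟩` splits. -/
lemma exists_common_value (ha : a ≠ 0) (hd : d ≠ 0) [NeZero (2 : F)]
    (h : IsPureSquare a b d) :
    ∃ c : F, c ≠ 0 ∧ IsQuadNorm (-(a * b)) (a * c) ∧ IsQuadNorm (-(a * b * d)) (a * b * c) := by
  obtain ⟨x, y, z, h⟩ := h
  by_cases hc : a * x ^ 2 + b * y ^ 2 = 0
  · refine ⟨a, ha, ⟨a, 0, by ring⟩, ?_⟩
    have hz : a * b * z ≠ 0 := by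
      intro hz
      apply hd
      rw [← h, hc]
      linear_combination -z * hz
    have : -(a * b * d) = (a * b * z) ^ 2 := by linear_combination a * b * (h - hc)
    rw [this]
    exact .of_sq hz _
  · refine ⟨a * x ^ 2 + b * y ^ 2, hc, ⟨a * x, y, by ring⟩, ⟨a * b * z, 1, ?_⟩⟩
    linear_combination -a * b * h

lemma of_common_value (ha : a ≠ 0) (hb : b ≠ 0) [NeZero (2 : F)] {c : F} (hc : c ≠ 0)
    (h₁ : IsQuadNorm (-(a * b)) (a * c)) (h₂ : IsQuadNorm (-(a * b * d)) (a * b * c)) :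
    IsPureSquare a b d := by
  obtain ⟨x, y, h₁⟩ := h₁
  obtain ⟨z, t, h₂⟩ := h₂
  have h₃ : a * b * (x ^ 2 + a * b * y ^ 2) = a * (z ^ 2 + a * b * d * t ^ 2) := by
    linear_combination a * b * h₁ - a * h₂
  have h₄ : b * x ^ 2 + a * b ^ 2 * y ^ 2 - z ^ 2 = a * b * d * t ^ 2 := by
    apply mul_left_cancel₀ ha
    linear_combination h₃
  by_cases ht : t = 0
  · subst ht
    have hz : z ≠ 0 := by
      rintro rfl
      apply mul_ne_zero (mul_ne_zero ha hb) hc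
      linear_combination -h₂
    refine of_isotropic ha hb (x := x / a) (y := y) (z := z / (a * b)) ?_
      (.inr (.inr (by positivity))) d
    field_simp
    linear_combination h₄
  · refine ⟨x / (a * t), y / t, z / (a * b * t), ?_⟩
    field_simp
    linear_combination h₄

end IsPureSquare

section PadicSquares

variable {p : ℕ} [hp : Fact p.Prime]

lemma PadicInt.isSquare_of_norm_lt {u a : ℤ_[p]} (h : ‖a ^ 2 - u‖ < ‖2 * a‖ ^ 2) : IsSquare u := by
  obtain ⟨z, hz, -⟩ := hensels_lemma (F := (X ^ 2 - C u : ℤ_[p][X])) (a := a)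
    (by simpa [derivative_X_pow, one_add_one_eq_two] using h)
  refine ⟨z, ?_⟩
  simp [sub_eq_zero] at hz
  rw [← hz, pow_two]

lemma PadicInt.isSquare_of_pow_three_dvd {u a : ℤ_[p]} (ha : ‖a‖ = 1)
    (h : (p : ℤ_[p]) ^ 3 ∣ a ^ 2 - u) : IsSquare u := by
  apply PadicInt.isSquare_of_norm_lt (a := a)
  obtain ⟨k, hk⟩ := h
  have hp1 : (1 : ℝ) < p := by exact_mod_cast hp.out.one_lt
  have h2 : (p : ℝ)⁻¹ ≤ ‖(2 : ℤ_[p])‖ := by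
    by_cases hp2 : p = 2
    · subst hp2
      exact (PadicInt.norm_p (p := 2)).ge
    · have : ‖((2 : ℕ) : ℤ_[p])‖ = 1 := by
        rw [PadicInt.norm_natCast_eq_one_iff, Nat.coprime_primes hp.out Nat.prime_two]
        exact hp2
      rw [Nat.cast_ofNat] at this
      rw [this]
      exact inv_le_one_of_one_le₀ hp1.le
  calc ‖a ^ 2 - u‖ = (p : ℝ)⁻¹ ^ 3 * ‖k‖ := by rw [hk, norm_mul, norm_pow, PadicInt.norm_p]
    _ ≤ (p : ℝ)⁻¹ ^ 3 := mul_le_of_le_one_right (by positivity) k.norm_le_one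
    _ < (p : ℝ)⁻¹ ^ 2 :=
      pow_lt_pow_right_of_lt_one₀ (by positivity) (inv_lt_one_of_one_lt₀ hp1) (by norm_num)
    _ ≤ _ := by
      rw [norm_mul, ha, mul_one]
      gcongr

lemma Padic.isSquare_intCast_of_zmod (hp2 : p ≠ 2) {n : ℤ} (hn : ¬ (p : ℤ) ∣ n)
    (h : IsSquare (n : ZMod p)) : IsSquare (n : ℚ_[p]) := by
  obtain ⟨r, hr⟩ := h
  obtain ⟨r, rfl⟩ := ZMod.intCast_surjective r
  have hdvd : (p : ℤ) ∣ r ^ 2 - n := by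
    rw [← ZMod.intCast_zmod_eq_zero_iff_dvd]
    push_cast
    rw [hr]
    ring
  have hr' : ¬ (p : ℤ) ∣ 2 * r := by
    intro h
    rcases (Nat.prime_iff_prime_int.mp hp.out).dvd_or_dvd h with h | h
    · exact hp2 ((Nat.prime_dvd_prime_iff_eq hp.out Nat.prime_two).mp (by exact_mod_cast h))
    · exact hn ((dvd_sub_right (dvd_pow h two_ne_zero)).mp hdvd)
  have : IsSquare (n : ℤ_[p]) := by
    apply PadicInt.isSquare_of_norm_lt (a := r)
    have h1 : ‖((2 * r : ℤ) : ℤ_[p])‖ = 1 := by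
      rw [PadicInt.norm_intCast_eq_one_iff, isCoprime_comm,
        (Nat.prime_iff_prime_int.mp hp.out).coprime_iff_not_dvd]
      exact hr'
    have h2 := (PadicInt.norm_int_lt_one_iff_dvd (p := p) _).mpr hdvd
    push_cast at h1 h2
    rw [h1]
    simpa using h2
  exact_mod_cast this.map (PadicInt.Coe.ringHom (p := p))

lemma Padic.isSquare_intCast_of_pow_three_dvd {n r : ℤ} (hr : ¬ (p : ℤ) ∣ r)
    (h : (p : ℤ) ^ 3 ∣ r ^ 2 - n) : IsSquare (n : ℚ_[p]) := by
  have : IsSquare (n : ℤ_[p]) := by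
    apply PadicInt.isSquare_of_pow_three_dvd (a := r)
    · rw [PadicInt.norm_intCast_eq_one_iff, isCoprime_comm,
        (Nat.prime_iff_prime_int.mp hp.out).coprime_iff_not_dvd]
      exact hr
    · exact_mod_cast (PadicInt.pow_p_dvd_int_iff 3 _).mpr h
  exact_mod_cast this.map (PadicInt.Coe.ringHom (p := p))

/-- Representatives of the square classes of `ℚ_[p]`. -/
lemma Padic.exists_eq_mul_sq {x : ℚ_[p]} (hx : x ≠ 0) : ∃ (e m : ℕ) (s : ℚ_[p]),
    e < 2 ∧ m < p ^ 3 ∧ ¬ p ∣ m ∧ s ≠ 0 ∧ x = ((p ^ e * m : ℕ) : ℚ_[p]) * s ^ 2 := by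
  have hp0 : (p : ℚ_[p]) ≠ 0 := by exact_mod_cast hp.out.ne_zero
  have hu : ‖x * (p : ℚ_[p]) ^ (-x.valuation)‖ = 1 := by
    rw [norm_mul, Padic.norm_eq_zpow_neg_valuation hx, Padic.norm_p_zpow, neg_neg,
      ← zpow_add₀ (by exact_mod_cast hp.out.ne_zero)]
    simp
  set u : ℤ_[p] := ⟨_, hu.le⟩ with hudef
  have hun : ‖u‖ = 1 := hu
  set m := u.appr 3
  have hdvd : (p : ℤ_[p]) ^ 3 ∣ u - m := Ideal.mem_span_singleton.mp (PadicInt.appr_spec 3 u)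
  have hpm : ¬ p ∣ m := by
    intro h
    have h1 : (p : ℤ_[p]) ∣ (m : ℤ_[p]) := by exact_mod_cast Nat.cast_dvd_cast (α := ℤ_[p]) h
    have h2 : (p : ℤ_[p]) ∣ u := by
      have := (dvd_pow_self (p : ℤ_[p]) three_ne_zero).trans hdvd
      exact (dvd_sub_left h1).mp this
    exact absurd ((PadicInt.norm_lt_one_iff_dvd u).mpr h2) (by simp [hun])
  have hm1 : ‖(m : ℤ_[p])‖ = 1 := by
    rw [PadicInt.norm_natCast_eq_one_iff]
    exact (hp.out.coprime_iff_not_dvd).mpr hpm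
  obtain ⟨s, hs⟩ : IsSquare (u * m) := by
    apply PadicInt.isSquare_of_pow_three_dvd hm1
    rw [show (m : ℤ_[p]) ^ 2 - u * m = (u - m) * (-m) by ring]
    exact hdvd.mul_right _
  have hm0 : (m : ℚ_[p]) ≠ 0 := by
    have : m ≠ 0 := by rintro h; simp [h] at hpm
    exact_mod_cast this
  have hs' : x * (p : ℚ_[p]) ^ (-x.valuation) * m = s * s := by
    have := congrArg (fun t : ℤ_[p] ↦ (t : ℚ_[p])) hs
    simpa only [PadicInt.coe_mul, PadicInt.coe_natCast] using this
  have hs0 : (s : ℚ_[p]) ≠ 0 := by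
    intro h
    rw [h, mul_zero] at hs'
    simp [hx, hm0, hp0, zpow_ne_zero] at hs'
  obtain ⟨k, e, he, hk⟩ : ∃ (k : ℤ) (e : ℕ), e < 2 ∧ x.valuation = e + 2 * k := 
    ⟨x.valuation / 2, (x.valuation % 2).toNat, by omega, by omega⟩
  refine ⟨e, m, s / m * (p : ℚ_[p]) ^ k, he, PadicInt.appr_lt u 3, hpm, ?_, ?_⟩
  · exact mul_ne_zero (div_ne_zero hs0 hm0) (zpow_ne_zero _ hp0)
  · have hpk : (p : ℚ_[p]) ^ x.valuation = p ^ e * (p ^ k) ^ 2 := by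
      rw [hk, zpow_add₀ hp0, zpow_natCast, mul_comm 2 k, zpow_mul]
      norm_cast
    have hx' : x * m = s * s * (p ^ e * (p ^ k) ^ 2) := by
      rw [← hs', ← hpk, zpow_neg]
      field_simp
    push_cast
    field_simp
    linear_combination hx'

end PadicSquares

lemma IsPureSquare.of_isQuadNorm {F : Type*} [Field F] [NeZero (2 : F)] {a b : F} (ha : a ≠ 0)
    (hb : b ≠ 0) (h : IsQuadNorm a b) (d : F) : IsPureSquare a b d := by
  obtain ⟨x, y, h⟩ := h
  refine of_isotropic ha hb (x := b) (y := a * y) (z := x) ?_ (.inl hb) d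
  linear_combination -a * b * h

section LocalForms

variable {p : ℕ} [hp : Fact p.Prime]

lemma ZMod.exists_sq_sub_mul_sq_eq (hp2 : p ≠ 2) {u : ZMod p} (hu : u ≠ 0) (w : ZMod p) :
    ∃ x y : ZMod p, x ^ 2 - u * y ^ 2 = w := by
  obtain ⟨x, y, h⟩ := FiniteField.exists_root_sum_quadratic (R := ZMod p)
    (f := X ^ 2 - C w) (g := C (-u) * X ^ 2) (degree_X_pow_sub_C (by decide) _)
    (degree_C_mul_X_pow 2 (neg_ne_zero.mpr hu))
    (by rw [ZMod.card]; exact hp.out.eq_two_or_odd.resolve_left hp2)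
  refine ⟨x, y, ?_⟩
  simp only [eval_sub, eval_pow, eval_X, eval_C, eval_mul] at h
  linear_combination h

lemma Padic.isQuadNorm_of_not_dvd (hp2 : p ≠ 2) {u w : ℤ} (hu : ¬ (p : ℤ) ∣ u)
    (hw : ¬ (p : ℤ) ∣ w) : IsQuadNorm (u : ℚ_[p]) w := by
  have hu' : (u : ZMod p) ≠ 0 := by rwa [Ne, ZMod.intCast_zmod_eq_zero_iff_dvd]
  have hw' : (w : ZMod p) ≠ 0 := by rwa [Ne, ZMod.intCast_zmod_eq_zero_iff_dvd]
  have hu0 : (u : ℚ_[p]) ≠ 0 := by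
    have : u ≠ 0 := by rintro rfl; simp at hu
    exact_mod_cast this
  obtain ⟨x, y, h⟩ := ZMod.exists_sq_sub_mul_sq_eq hp2 hu' (w : ZMod p)
  obtain ⟨y, rfl⟩ := ZMod.intCast_surjective y
  by_cases hx : x = 0
  · obtain ⟨s, hs⟩ := Padic.isSquare_intCast_of_zmod hp2 (n := -u * w)
      (by
        rw [← ZMod.intCast_zmod_eq_zero_iff_dvd]
        push_cast
        exact mul_ne_zero (neg_ne_zero.mpr hu') hw')
      ⟨u * y, by push_cast; rw [← h, hx]; ring⟩
    push_cast at hs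
    refine ⟨0, s / u, ?_⟩
    field_simp
    linear_combination hs
  · obtain ⟨s, hs⟩ := Padic.isSquare_intCast_of_zmod hp2 (n := w + u * y ^ 2)
      (by
        rw [← ZMod.intCast_zmod_eq_zero_iff_dvd]
        push_cast
        rw [← h, sub_add_cancel]
        exact pow_ne_zero 2 hx)
      ⟨x, by push_cast; rw [← h]; ring⟩
    push_cast at hs
    exact ⟨s, y, by linear_combination -hs⟩

lemma ZMod.isSquare_mul_of_not_isSquare {u w : ℤ}
    (hu : ¬ IsSquare (u : ZMod p)) (hw : ¬ IsSquare (w : ZMod p)) :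
    IsSquare ((u * w : ℤ) : ZMod p) := by
  have h : legendreSym p (u * w) = 1 := by
    rw [legendreSym.mul, (legendreSym.eq_neg_one_iff p).mpr hu,
      (legendreSym.eq_neg_one_iff p).mpr hw]
    norm_num
  refine (legendreSym.eq_one_iff p fun h0 ↦ ?_).mp h
  rw [(legendreSym.eq_zero_iff p _).mpr h0] at h
  exact zero_ne_one h

lemma Padic.isPureSquare_unit_left (hp2 : p ≠ 2) {u m n : ℤ} {e f : ℕ} (hu : ¬ (p : ℤ) ∣ u)
    (hm : ¬ (p : ℤ) ∣ m) (hn : ¬ (p : ℤ) ∣ n) (he : e < 2) (hf : f < 2)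
    (hd : ¬ IsSquare ((p ^ f * n : ℤ) : ℚ_[p])) :
    IsPureSquare (u : ℚ_[p]) (p ^ e * m : ℤ) (p ^ f * n : ℤ) := by
  have ne0 {k : ℤ} (hk : ¬ (p : ℤ) ∣ k) : (k : ℚ_[p]) ≠ 0 := by
    have : k ≠ 0 := by rintro rfl; simp at hk
    exact_mod_cast this
  have hp0 : (p : ℚ_[p]) ≠ 0 := by exact_mod_cast hp.out.ne_zero
  have hu0 := ne0 hu
  have hm0 := ne0 hm
  have hb0 : ((p ^ e * m : ℤ) : ℚ_[p]) ≠ 0 := by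
    push_cast
    exact mul_ne_zero (pow_ne_zero _ hp0) hm0
  have hprime := Nat.prime_iff_prime_int.mp hp.out
  by_cases hu2 : IsSquare (u : ZMod p)
  · exact .of_isQuadNorm hu0 hb0
      (.of_isSquare hu0 (Padic.isSquare_intCast_of_zmod hp2 hu hu2) _) _
  interval_cases e
  · refine .of_isQuadNorm hu0 hb0 ?_ _
    simpa using Padic.isQuadNorm_of_not_dvd hp2 hu hm
  interval_cases f
  · have hn2 : ¬ IsSquare (n : ZMod p) := fun h ↦ hd <| by
      simpa using Padic.isSquare_intCast_of_zmod hp2 hn h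
    obtain ⟨t, ht⟩ := Padic.isSquare_intCast_of_zmod hp2 (hprime.not_dvd_mul hu hn)
      (ZMod.isSquare_mul_of_not_isSquare hu2 hn2)
    push_cast at ht
    refine ⟨t / u, 0, 0, ?_⟩
    push_cast
    field_simp
    linear_combination -ht
  · obtain ⟨x, y, h⟩ := Padic.isQuadNorm_of_not_dvd hp2 hu (hprime.not_dvd_mul hm hn)
    push_cast at h
    refine ⟨0, x / m, y / m, ?_⟩
    push_cast
    field_simp
    linear_combination p * h

lemma Padic.isPureSquare_two_reps : ∀ e₁ e₂ e₃ : Fin 2, ∀ i j l : Fin 4, (e₃ = 0 → l ≠ 0) →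
    ∃ k : Fin 2, ∃ x y z : Fin 4,
      (2 ^ e₁.val * (2 * i.val + 1) * x.val ^ 2 + 2 ^ e₂.val * (2 * j.val + 1) * y.val ^ 2 -
        (2 ^ e₁.val * (2 * i.val + 1)) * (2 ^ e₂.val * (2 * j.val + 1)) * z.val ^ 2 -
        2 ^ e₃.val * (2 * l.val + 1) * 4 ^ k.val : ℤ) % (8 * 4 ^ k.val * 2 ^ e₃.val) = 0 := by
  decide +kernel

lemma Padic.isPureSquare_of_eq_two {a b d : ℚ_[2]} (ha : a ≠ 0) (hb : b ≠ 0) (hd : d ≠ 0)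
    (hd2 : ¬ IsSquare d) : IsPureSquare a b d := by
  have odd_rep {m : ℕ} (hm : m < 2 ^ 3) (h : ¬ 2 ∣ m) : ∃ i : Fin 4, m = 2 * i.val + 1 :=
    ⟨⟨m / 2, by omega⟩, by simp only; omega⟩
  obtain ⟨e₁, m₁, s₁, he₁, hm₁, h₁, hs₁, rfl⟩ := Padic.exists_eq_mul_sq ha
  obtain ⟨e₂, m₂, s₂, he₂, hm₂, h₂, hs₂, rfl⟩ := Padic.exists_eq_mul_sq hb
  obtain ⟨e₃, m₃, s₃, he₃, hm₃, h₃, hs₃, rfl⟩ := Padic.exists_eq_mul_sq hd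
  rw [IsPureSquare.left_mul_sq_iff hs₁, IsPureSquare.right_mul_sq_iff hs₂,
    IsPureSquare.mul_sq_iff hs₃]
  obtain ⟨i, rfl⟩ := odd_rep hm₁ h₁
  obtain ⟨j, rfl⟩ := odd_rep hm₂ h₂
  obtain ⟨l, rfl⟩ := odd_rep hm₃ h₃
  obtain ⟨k, x, y, z, h⟩ := Padic.isPureSquare_two_reps ⟨e₁, he₁⟩ ⟨e₂, he₂⟩ ⟨e₃, he₃⟩ i j l <| by
    intro he hl
    refine hd2 ⟨s₃, ?_⟩
    rw [Fin.mk_eq_zero] at he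
    simp [he, hl, pow_two]
  obtain ⟨c, hc⟩ := Int.dvd_of_emod_eq_zero h
  obtain ⟨t, ht⟩ := Padic.isSquare_intCast_of_pow_three_dvd (p := 2)
    (n := (2 * l.val + 1) ^ 2 + 8 * (c * (2 * l.val + 1))) (r := 2 * l.val + 1) (by omega)
    ⟨-(c * (2 * l.val + 1)), by push_cast; ring⟩
  have hl : (2 * (l.val : ℚ_[2]) + 1) ≠ 0 := by exact_mod_cast (2 * l.val).succ_ne_zero
  rw [← IsPureSquare.mul_sq_iff (s := 2 ^ k.val * t / (2 * l.val + 1))]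
  · refine ⟨x.val, y.val, z.val, ?_⟩
    replace hc := congrArg (fun n : ℤ ↦ (n : ℚ_[2])) hc
    push_cast at hc ht ⊢
    have h4 : (4 : ℚ_[2]) ^ k.val = (2 ^ k.val) ^ 2 := by
      rw [← pow_mul, mul_comm, pow_mul]; norm_num
    rw [h4] at hc
    field_simp
    linear_combination (2 * (l.val : ℚ_[2]) + 1) * hc + 2 ^ e₃ * (2 ^ k.val) ^ 2 * ht
  · refine div_ne_zero (mul_ne_zero (pow_ne_zero _ two_ne_zero) ?_) hl
    rintro rfl
    have h0 : (2 * (l.val : ℤ) + 1) ^ 2 + 8 * (c * (2 * l.val + 1)) = 0 := by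
      exact_mod_cast ht.trans (mul_zero 0)
    have : (2 * (l.val : ℤ) + 1) * ((2 * l.val + 1) + 8 * c) = 0 := by linear_combination h0
    rcases mul_eq_zero.mp this with h | h <;> omega

/-- Every non-square of `ℚ_[p]` is the square of a pure quaternion. -/
lemma Padic.isPureSquare_of_not_isSquare {a b d : ℚ_[p]} (ha : a ≠ 0) (hb : b ≠ 0) (hd : d ≠ 0)
    (hd2 : ¬ IsSquare d) : IsPureSquare a b d := by
  by_cases hp2 : p = 2
  · subst hp2
    exact isPureSquare_of_eq_two ha hb hd hd2
  obtain ⟨e₁, m₁, s₁, he₁, -, h₁, hs₁, rfl⟩ := Padic.exists_eq_mul_sq ha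
  obtain ⟨e₂, m₂, s₂, he₂, -, h₂, hs₂, rfl⟩ := Padic.exists_eq_mul_sq hb
  obtain ⟨e₃, m₃, s₃, he₃, -, h₃, hs₃, rfl⟩ := Padic.exists_eq_mul_sq hd
  rw [IsPureSquare.left_mul_sq_iff hs₁, IsPureSquare.right_mul_sq_iff hs₂,
    IsPureSquare.mul_sq_iff hs₃]
  have hd3 : ¬ IsSquare ((p ^ e₃ * m₃ : ℤ) : ℚ_[p]) := by
    rintro ⟨t, ht⟩
    push_cast at ht
    exact hd2 ⟨t * s₃, by push_cast; rw [ht]; ring⟩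
  have hp0 : (p : ℚ_[p]) ≠ 0 := by exact_mod_cast hp.out.ne_zero
  have hm₁ : (m₁ : ℚ_[p]) ≠ 0 := by
    have : m₁ ≠ 0 := by rintro rfl; simp at h₁
    exact_mod_cast this
  rw [← Int.natCast_dvd_natCast] at h₁ h₂ h₃
  interval_cases e₁
  · simpa using isPureSquare_unit_left hp2 h₁ h₂ h₃ he₂ he₃ hd3
  interval_cases e₂
  · rw [IsPureSquare.comm]
    simpa using isPureSquare_unit_left hp2 (e := 1) h₂ h₁ h₃ (by norm_num) he₃ hd3
  · have h₁₂ : ¬ (p : ℤ) ∣ -(m₁ * m₂) := by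
      rw [dvd_neg]
      exact (Nat.prime_iff_prime_int.mp hp.out).not_dvd_mul h₁ h₂
    rw [← IsPureSquare.neg_mul_iff (by push_cast; positivity), IsPureSquare.comm]
    have := isPureSquare_unit_left hp2 (e := 1) h₁₂ h₁ h₃ (by norm_num) he₃ hd3
    rw [← IsPureSquare.left_mul_sq_iff hp0] at this
    convert this using 1 <;> push_cast <;> ring

end LocalForms

section Legendre

lemma Padic.exists_padicInt_of_isQuadNorm {p : ℕ} [hp : Fact p.Prime] {u w : ℤ}
    (hu : (p : ℤ) ∣ u) (hu2 : ¬ (p : ℤ) ^ 2 ∣ u) (hw : ¬ (p : ℤ) ∣ w)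
    (h : IsQuadNorm (u : ℚ_[p]) w) : ∃ x y : ℤ_[p], x ^ 2 - u * y ^ 2 = w := by
  obtain ⟨v, rfl⟩ := hu
  have hv : ¬ (p : ℤ) ∣ v := fun hv ↦ hu2 (by rw [pow_two]; exact mul_dvd_mul_left _ hv)
  have unit_norm {k : ℤ} (hk : ¬ (p : ℤ) ∣ k) : ‖(k : ℚ_[p])‖ = 1 := by
    rw [← PadicInt.coe_intCast, PadicInt.padic_norm_e_of_padicInt,
      PadicInt.norm_intCast_eq_one_iff, isCoprime_comm,
      (Nat.prime_iff_prime_int.mp hp.out).coprime_iff_not_dvd]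
    exact hk
  have hp1 : (1 : ℝ) < p := by exact_mod_cast hp.out.one_lt
  obtain ⟨x, y, h⟩ := h
  have hnorm : ‖((p * v : ℤ) : ℚ_[p]) * y ^ 2‖ = (p : ℝ)⁻¹ * ‖y‖ ^ 2 := by
    push_cast
    rw [norm_mul, norm_mul, unit_norm hv, Padic.norm_p, norm_pow, mul_one]
  have hy : ‖y‖ ≤ 1 := by
    by_contra! hy
    have hy0 : y ≠ 0 := by rintro rfl; simp at hy; linarith
    have hyv : y.valuation < 0 := by
      rw [Padic.norm_eq_zpow_neg_valuation hy0] at hy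
      have := (one_lt_zpow_iff_right₀ hp1).mp hy
      omega
    have hlt : 1 < (p : ℝ)⁻¹ * ‖y‖ ^ 2 := by
      rw [Padic.norm_eq_zpow_neg_valuation hy0, ← zpow_neg_one, ← zpow_natCast, ← zpow_mul,
        ← zpow_add₀ (by positivity)]
      apply one_lt_zpow₀ hp1
      push_cast
      omega
    have hx : ‖x ^ 2‖ = (p : ℝ)⁻¹ * ‖y‖ ^ 2 := by
      rw [sub_eq_iff_eq_add.mp h, Padic.add_eq_max_of_ne, unit_norm hw, hnorm,
        max_eq_right hlt.le]
      rw [unit_norm hw, hnorm]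
      exact hlt.ne
    have hx0 : x ≠ 0 := by
      rintro rfl
      rw [← hx] at hlt
      norm_num at hlt
    rw [norm_pow, Padic.norm_eq_zpow_neg_valuation hy0, Padic.norm_eq_zpow_neg_valuation hx0,
      ← zpow_neg_one, ← zpow_natCast, ← zpow_natCast, ← zpow_mul, ← zpow_mul,
      ← zpow_add₀ (by positivity)] at hx
    have := zpow_right_injective₀ (by positivity) hp1.ne' hx
    push_cast at this
    omega
  have hx : ‖x‖ ≤ 1 := by
    have : ‖x ^ 2‖ ≤ 1 := by
      rw [sub_eq_iff_eq_add.mp h]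
      refine (Padic.nonarchimedean _ _).trans (max_le (unit_norm hw).le ?_)
      rw [hnorm]
      exact mul_le_one₀ (inv_le_one_of_one_le₀ hp1.le) (by positivity)
        (pow_le_one₀ (norm_nonneg _) hy)
    rwa [norm_pow, pow_le_one_iff_of_nonneg (norm_nonneg _) two_ne_zero] at this
  refine ⟨⟨x, hx⟩, ⟨y, hy⟩, PadicInt.ext ?_⟩
  push_cast at h ⊢
  exact h

lemma Padic.isSquare_zmod_of_isQuadNorm {p : ℕ} [hp : Fact p.Prime] {u w : ℤ} (hu : (p : ℤ) ∣ u)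
    (hu2 : ¬ (p : ℤ) ^ 2 ∣ u) (hw : ¬ (p : ℤ) ∣ w) (h : IsQuadNorm (u : ℚ_[p]) w) :
    IsSquare (w : ZMod p) := by
  obtain ⟨x, y, h⟩ := exists_padicInt_of_isQuadNorm hu hu2 hw h
  refine ⟨PadicInt.toZMod x, ?_⟩
  replace h := congrArg (PadicInt.toZMod (p := p)) h
  simp only [map_sub, map_mul, map_pow, map_intCast,
    (ZMod.intCast_zmod_eq_zero_iff_dvd u p).mpr hu, zero_mul, sub_zero] at h
  rw [← h, pow_two]

lemma ZMod.isSquare_of_squarefree {n : ℕ} {a : ℤ} (hn : Squarefree n)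
    (h : ∀ p : ℕ, p.Prime → p ∣ n → IsSquare (a : ZMod p)) : IsSquare (a : ZMod n) := by
  induction n using induction_on_primes with
  | zero => simp at hn
  | one => exact ⟨0, Subsingleton.elim _ _⟩
  | prime_mul p m hp ih =>
    obtain ⟨hcop, -, hm⟩ := (Nat.squarefree_mul_iff).mp hn
    obtain ⟨s, hs⟩ := ih hm fun q hq hqm ↦ h q hq (hqm.mul_left p)
    obtain ⟨r, hr⟩ := h p hp (dvd_mul_right p m)
    have : IsSquare (ZMod.chineseRemainder hcop (a : ZMod (p * m))) := by
      refine ⟨(r, s), ?_⟩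
      rw [map_intCast, Prod.mk_mul_mk, ← hr, ← hs]
      rfl
    simpa using this.map (ZMod.chineseRemainder hcop).symm

/-- Legendre's theorem: a ternary form which is isotropic over the reals and over `ℚ_[p]` for
every odd prime `p` is isotropic over the rationals. -/
theorem isQuadNorm_rat_of_local {u w : ℤ} (hu : u ≠ 0) (hw : w ≠ 0) (hneg : 0 < u ∨ 0 < w)
    (h : ∀ (p : ℕ) [Fact p.Prime], p ≠ 2 → IsQuadNorm (u : ℚ_[p]) w) :
    IsQuadNorm (u : ℚ) w := by
  induction hN : u.natAbs + w.natAbs using Nat.strong_induction_on generalizing u w with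
  | _ N ih =>
  wlog huw : u.natAbs ≤ w.natAbs generalizing u w
  · refine (IsQuadNorm.comm (by exact_mod_cast hu) (by exact_mod_cast hw)).mpr ?_
    refine this hw hu hneg.symm (fun p _ hp ↦ ?_) (by omega) (by omega)
    exact (h p hp).symm (by exact_mod_cast hw)
  by_cases hsq : Squarefree w
  swap
  · rw [Squarefree] at hsq
    push Not at hsq
    obtain ⟨s, ⟨v, rfl⟩, hs⟩ := hsq
    have hs0 : s ≠ 0 := by rintro rfl; simp at hw
    have hv0 : v ≠ 0 := by rintro rfl; simp at hw
    have hs1 : 2 ≤ s.natAbs := by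
      rw [Int.isUnit_iff_natAbs_eq] at hs
      have := Int.natAbs_ne_zero.mpr hs0
      omega
    have hlt : v.natAbs < (s * s * v).natAbs := by
      rw [Int.natAbs_mul, Int.natAbs_mul]
      exact lt_mul_of_one_lt_left (Int.natAbs_pos.mpr hv0) (by nlinarith)
    have hcast {F : Type} [Field F] : ((s * s * v : ℤ) : F) = v * (s : F) ^ 2 := by
      push_cast; ring
    rw [hcast, IsQuadNorm.mul_sq_iff (by exact_mod_cast hs0)]
    refine ih _ (by omega) hu hv0 (hneg.imp_right fun h ↦ ?_) (fun p _ hp ↦ ?_) rfl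
    · exact pos_of_mul_pos_right h (mul_self_nonneg s)
    · have := h p hp
      rwa [hcast, IsQuadNorm.mul_sq_iff (by exact_mod_cast hs0)] at this
  by_cases hw1 : w.natAbs = 1
  · rcases Int.natAbs_eq w with hw' | hw' <;> rw [hw1] at hw'
    · subst hw'
      exact ⟨1, 0, by simp⟩
    · obtain rfl : u = 1 := by omega
      simpa using IsQuadNorm.of_sq (one_ne_zero (α := ℚ)) (w : ℚ)
  have hw2 : 2 ≤ w.natAbs := by have := Int.natAbs_ne_zero.mpr hw; omega
  obtain ⟨r, hr⟩ : IsSquare (u : ZMod w.natAbs) := by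
    refine ZMod.isSquare_of_squarefree (Int.squarefree_natAbs.mpr hsq) fun p hp hpw ↦ ?_
    have : Fact p.Prime := ⟨hp⟩
    by_cases hp2 : p = 2
    · subst hp2
      generalize (u : ZMod 2) = t
      revert t
      decide
    by_cases hpu : (p : ℤ) ∣ u
    · rw [(ZMod.intCast_zmod_eq_zero_iff_dvd u p).mpr hpu]
      exact IsSquare.zero
    · refine Padic.isSquare_zmod_of_isQuadNorm (Int.natCast_dvd.mpr hpw) ?_ hpu
        ((h p hp2).symm (by exact_mod_cast hw))
      rw [pow_two]
      intro hdvd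
      exact (Nat.prime_iff_prime_int.mp hp).not_isUnit (hsq _ hdvd)
  obtain ⟨r, rfl, hrw⟩ : ∃ r' : ℤ, (r' : ZMod w.natAbs) = r ∧ 2 * r'.natAbs ≤ w.natAbs := by
    have : NeZero w.natAbs := ⟨by omega⟩
    refine ⟨r.valMinAbs, r.coe_valMinAbs, ?_⟩
    have := r.natAbs_valMinAbs_le
    omega
  obtain ⟨v, hv⟩ : w ∣ r ^ 2 - u := by
    rw [← Int.natAbs_dvd, ← ZMod.intCast_zmod_eq_zero_iff_dvd]
    push_cast
    rw [hr]
    ring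
  have hwv {F : Type} [Field F] : IsQuadNorm (u : F) (w * v) :=
    ⟨r, 1, by rw [one_pow, mul_one]; exact_mod_cast congrArg (fun n : ℤ ↦ (n : F)) hv⟩
  by_cases hv0 : v = 0
  · refine IsQuadNorm.of_isSquare (F := ℚ) (by exact_mod_cast hu) ⟨r, ?_⟩ _
    rw [hv0, mul_zero, sub_eq_zero] at hv
    rw [← hv]
    push_cast
    ring
  have hlt : v.natAbs < w.natAbs := by
    have h1 : w.natAbs * v.natAbs ≤ r.natAbs ^ 2 + u.natAbs := by
      rw [← Int.natAbs_mul, ← hv, ← Int.natAbs_pow]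
      exact Int.natAbs_sub_le _ _
    by_contra! hle
    have h2 := Nat.mul_le_mul_left w.natAbs hle
    have h3 := Nat.mul_le_mul_left w.natAbs hw2
    have h4 := Nat.pow_le_pow_left hrw 2
    nlinarith
  have key : IsQuadNorm (u : ℚ) v := by
    refine ih _ (by omega) hu hv0 ?_ (fun p _ hp ↦ ?_) rfl
    · by_contra! hcon
      have hw' : 0 < w := hneg.resolve_left (by omega)
      have hv' : v < 0 := by omega
      nlinarith [sq_nonneg r, hcon.1]
    · exact IsQuadNorm.of_mul (by exact_mod_cast hw) (h p hp) hwv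
  refine IsQuadNorm.of_mul (by exact_mod_cast hv0) key ?_
  rw [mul_comm]
  exact hwv

end Legendre

section Reciprocity

open ZMod NumberTheorySymbols

lemma jacobiSym_eq_one_of_isSquare {a : ℤ} {n : ℕ} (hcop : IsCoprime a n)
    (h : ∀ p : ℕ, p.Prime → p ∣ n → IsSquare (a : ZMod p)) : J(a | n) = 1 := by
  refine (jacobiSym.eq_one_or_neg_one (Int.isCoprime_iff_gcd_eq_one.mp hcop)).resolve_right ?_
  intro h1
  obtain ⟨p, hp, hpn, hJ⟩ := jacobiSym.eq_neg_one_at_prime_divisor_of_eq_neg_one h1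
  exact ZMod.nonsquare_of_jacobiSym_eq_neg_one hJ (h p hp hpn)

/-- The sign in the law of quadratic reciprocity, in terms of the values of `χ₄`. -/
def reciprocitySign (x y : ℤ) : ℤ := if x = -1 ∧ y = -1 then -1 else 1

lemma jacobiSym_mul_swap {m n : ℕ} (hm : Odd m) (hn : Odd n) (hmn : m.Coprime n) :
    J(m | n) * J(n | m) = reciprocitySign (χ₄ m) (χ₄ n) := by
  have h1 : J(n | m) * J(n | m) = 1 := by
    rw [← pow_two]
    exact jacobiSym.sq_one (by simpa using hmn.symm)
  rcases Nat.odd_mod_four_iff.mp (Nat.odd_iff.mp hm) with hm4 | hm4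
  · rw [jacobiSym.quadratic_reciprocity_one_mod_four hm4 hn, h1, χ₄_nat_one_mod_four hm4]
    simp [reciprocitySign]
  rcases Nat.odd_mod_four_iff.mp (Nat.odd_iff.mp hn) with hn4 | hn4
  · rw [jacobiSym.quadratic_reciprocity_one_mod_four' hm hn4, h1, χ₄_nat_one_mod_four hn4]
    simp [reciprocitySign]
  · rw [jacobiSym.quadratic_reciprocity_three_mod_four hm4 hn4, neg_mul, h1,
      χ₄_nat_three_mod_four hm4, χ₄_nat_three_mod_four hn4]
    simp [reciprocitySign]

/-- The condition modulo `8` under which `2 ^ α * U` and `2 ^ β * W`, for odd `U` and `W`, have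
trivial Hilbert symbol over `ℚ_[2]`. -/
def DyadicCond (α β : Fin 2) (U W : ZMod 8) : Prop :=
  if α = 0 then if β = 0 then 2 * U = 2 ∨ 2 * W = 2 else U = 1 ∨ U + 2 * W = 1
  else if β = 0 then W = 1 ∨ W + 2 * U = 1 else -(U * W) = 1 ∨ -(U * W) + 2 * U = 1

instance (α β : Fin 2) (U W : ZMod 8) : Decidable (DyadicCond α β U W) := by
  unfold DyadicCond
  infer_instance

lemma Padic.two_mul_eq_two_of_isQuadNorm {U W : ℤ} (hU : Odd U) (hW : Odd W)
    (h : IsQuadNorm (U : ℚ_[2]) W) : 2 * (U : ZMod 8) = 2 ∨ 2 * (W : ZMod 8) = 2 := by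
  obtain ⟨k, rfl⟩ := hU
  obtain ⟨l, rfl⟩ := hW
  suffices key : ∃ x y z : ℤ_[2], (x = 1 ∨ y = 1 ∨ z = 1) ∧
      x ^ 2 - (2 * k + 1) * y ^ 2 = (2 * l + 1) * z ^ 2 by
    obtain ⟨x, y, z, h1, h⟩ := key
    have dec : ∀ x y z : ZMod 8, (x = 1 ∨ y = 1 ∨ z = 1) → ∀ k l : ZMod 8,
        x ^ 2 - (2 * k + 1) * y ^ 2 = (2 * l + 1) * z ^ 2 →
        2 * (2 * k + 1) = 2 ∨ 2 * (2 * l + 1) = 2 := by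
      decide +kernel
    obtain ⟨f⟩ : Nonempty (ℤ_[2] →+* ZMod 8) := ⟨PadicInt.toZModPow 3⟩
    have := dec (f x) (f y) (f z) (by rcases h1 with rfl | rfl | rfl <;> simp) k l
      (by simpa [map_ofNat f 2] using congrArg f h)
    exact_mod_cast this
  obtain ⟨x, y, h⟩ := h
  push_cast at h
  have main {m : ℚ_[2]} (h1 : ‖(1 : ℚ_[2])‖ ≤ ‖m‖) (hx : ‖x‖ ≤ ‖m‖) (hy : ‖y‖ ≤ ‖m‖)
      (hm : x = m ∨ y = m ∨ 1 = m) : ∃ x y z : ℤ_[2], (x = 1 ∨ y = 1 ∨ z = 1) ∧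
      x ^ 2 - (2 * k + 1) * y ^ 2 = (2 * l + 1) * z ^ 2 := by
    have hm0 : m ≠ 0 := by rintro rfl; norm_num at h1
    have hn {t : ℚ_[2]} (ht : ‖t‖ ≤ ‖m‖) : ‖t / m‖ ≤ 1 := by
      rw [norm_div]
      exact div_le_one_of_le₀ ht (norm_nonneg _)
    refine ⟨⟨x / m, hn hx⟩, ⟨y / m, hn hy⟩, ⟨1 / m, hn h1⟩, ?_, PadicInt.ext ?_⟩
    · refine hm.imp ?_ (Or.imp ?_ ?_) <;> rintro rfl <;> exact PadicInt.ext (div_self hm0)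
    · change (x / m) ^ 2 - (2 * k + 1) * (y / m) ^ 2 = (2 * l + 1) * (1 / m) ^ 2
      field_simp
      exact h
  rcases le_total ‖x‖ ‖y‖ with hxy | hxy
  · rcases le_total ‖(1 : ℚ_[2])‖ ‖y‖ with hy | hy
    · exact main hy hxy le_rfl (.inr (.inl rfl))
    · exact main le_rfl (hxy.trans hy) hy (.inr (.inr rfl))
  · rcases le_total ‖(1 : ℚ_[2])‖ ‖x‖ with hx | hx
    · exact main hx le_rfl hxy (.inl rfl)
    · exact main le_rfl hx (hxy.trans hx) (.inr (.inr rfl))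

lemma Padic.eq_one_of_isQuadNorm_two_mul {U W : ℤ} (hU : Odd U) (hW : Odd W)
    (h : IsQuadNorm ((2 * U : ℤ) : ℚ_[2]) W) :
    (W : ZMod 8) = 1 ∨ (W : ZMod 8) + 2 * (U : ZMod 8) = 1 := by
  obtain ⟨k, rfl⟩ := hU
  obtain ⟨l, rfl⟩ := hW
  obtain ⟨x, y, h⟩ := Padic.exists_padicInt_of_isQuadNorm (by simp) (by push_cast; omega)
    (by push_cast; omega) h
  have dec : ∀ x y k l : ZMod 8, x ^ 2 - 2 * (2 * k + 1) * y ^ 2 = 2 * l + 1 →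
      2 * l + 1 = 1 ∨ 2 * l + 1 + 2 * (2 * k + 1) = 1 := by
    decide +kernel
  obtain ⟨f⟩ : Nonempty (ℤ_[2] →+* ZMod 8) := ⟨PadicInt.toZModPow 3⟩
  have := dec (f x) (f y) k l (by simpa [map_ofNat f 2] using congrArg f h)
  exact_mod_cast this

lemma dyadicCond_of_isQuadNorm (α β : Fin 2) {U W : ℤ} (hU : Odd U) (hW : Odd W)
    (h : IsQuadNorm ((2 ^ α.val * U : ℤ) : ℚ_[2]) (2 ^ β.val * W : ℤ)) :
    DyadicCond α β U W := by
  have ne0 {k : ℤ} (hk : Odd k) : (k : ℚ_[2]) ≠ 0 := by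
    have : k ≠ 0 := by rintro rfl; simp at hk
    exact_mod_cast this
  have h2 : (2 : ℚ_[2]) ≠ 0 := two_ne_zero
  fin_cases α <;> fin_cases β <;> simp only [DyadicCond]
  · simpa using Padic.two_mul_eq_two_of_isQuadNorm hU hW (by simpa using h)
  · simpa using Padic.eq_one_of_isQuadNorm_two_mul hW hU
      (by simpa using h.symm (by simpa using ne0 hW))
  · simpa using Padic.eq_one_of_isQuadNorm_two_mul hU hW (by simpa using h)
  · have h' := h.mul (.neg_self _)
    have key := Padic.eq_one_of_isQuadNorm_two_mul hU (hU.mul hW).neg <| by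
      rw [← IsQuadNorm.mul_sq_iff h2]
      convert h' using 1
      · simp
      · push_cast
        simp
        ring
    push_cast at key
    simpa using key

/-- The value of the quadratic characters `-1` and `1` at an odd number modulo `8`. -/
def signChar (s : Bool) (n : ZMod 8) : ℤ := if s then χ₄ (ZMod.cast n : ZMod 4) else 1

/-- The sign with a given boolean code. -/
def boolSign (s : Bool) : ℤ := if s then -1 else 1

lemma reciprocity_mod_eight : ∀ g m n : Fin 4, ∀ α β : Fin 2, ∀ s t : Bool, (s && t) = false →
    let G : ZMod 8 := 2 * g.val + 1
    let M : ZMod 8 := 2 * m.val + 1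
    let N : ZMod 8 := 2 * n.val + 1
    DyadicCond α β (boolSign s * G * M) (boolSign t * G * N) →
    signChar t M * signChar s N * (signChar true G * signChar s G * signChar t G) *
      (χ₈ M ^ β.val * χ₈ N ^ α.val * χ₈ G ^ (α.val + β.val)) *
      (reciprocitySign (χ₄ (ZMod.cast G : ZMod 4)) (χ₄ (ZMod.cast M : ZMod 4)) *
       reciprocitySign (χ₄ (ZMod.cast G : ZMod 4)) (χ₄ (ZMod.cast N : ZMod 4)) *
       reciprocitySign (χ₄ (ZMod.cast M : ZMod 4)) (χ₄ (ZMod.cast N : ZMod 4))) = 1 := by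
  decide +kernel

lemma jacobiSym_boolSign (s : Bool) {n : ℕ} (hn : Odd n) : J(boolSign s | n) = signChar s n := by
  cases s
  · simp [boolSign, signChar]
  · simp [boolSign, signChar, jacobiSym.at_neg_one hn, ZMod.cast_natCast (show 4 ∣ 8 by norm_num)]

lemma ZMod.exists_fin_four_of_odd {n : ℕ} (hn : Odd n) :
    ∃ i : Fin 4, (n : ZMod 8) = 2 * i.val + 1 := by
  obtain ⟨k, rfl⟩ := hn
  refine ⟨⟨k % 4, Nat.mod_lt _ (by norm_num)⟩, ?_⟩
  have : ((2 * k + 1 : ℕ) : ZMod 8) = (2 * (k % 4) + 1 : ℕ) := by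
    rw [ZMod.natCast_eq_natCast_iff']
    omega
  simpa using this

lemma jacobiSym_eq_one_of_dyadicCond {g m n : ℕ} (hg : Odd g) (hm : Odd m) (hn : Odd n)
    (hgm : g.Coprime m) (hgn : g.Coprime n) (hmn : m.Coprime n) (α β : Fin 2) (s t : Bool)
    (hst : (s && t) = false)
    (hdy : DyadicCond α β (boolSign s * g * m) (boolSign t * g * n))
    (h₁ : J(boolSign t * 2 ^ β.val * (g * n) | m) = 1)
    (h₂ : J(boolSign true * boolSign s * boolSign t * 2 ^ (α.val + β.val) * (m * n) | g) = 1) :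
    J(boolSign s * 2 ^ α.val * (g * m) | n) = 1 := by
  obtain ⟨i, hi⟩ := ZMod.exists_fin_four_of_odd hg
  obtain ⟨j, hj⟩ := ZMod.exists_fin_four_of_odd hm
  obtain ⟨k, hk⟩ := ZMod.exists_fin_four_of_odd hn
  have key := reciprocity_mod_eight i j k α β s t hst
  simp only [← hi, ← hj, ← hk, ZMod.cast_natCast (show 4 ∣ 8 by norm_num)] at key
  specialize key hdy
  rw [← jacobiSym_mul_swap hg hm hgm, ← jacobiSym_mul_swap hg hn hgn,
    ← jacobiSym_mul_swap hm hn hmn] at key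
  simp only [jacobiSym.mul_left, jacobiSym.pow_left, jacobiSym_boolSign, hg, hm, hn,
    jacobiSym.at_two] at h₁ h₂ ⊢
  have cancel {x y z : ℤ} (hy : y = 1) (hz : z = 1) (h : x * y * z = 1) : x = 1 := by
    simpa [hy, hz] using h
  refine cancel h₁ h₂ ?_
  linear_combination key

lemma jacobiSym_eq_one_of_isQuadNorm {u v : ℤ} {n : ℕ} (hu : Squarefree u) (hnu : (n : ℤ) ∣ u)
    (hcop : IsCoprime v n)
    (h : ∀ (p : ℕ) [Fact p.Prime], p ∣ n → IsQuadNorm (u : ℚ_[p]) v) : J(v | n) = 1 := by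
  refine jacobiSym_eq_one_of_isSquare hcop fun p hp hpn ↦ ?_
  have : Fact p.Prime := ⟨hp⟩
  have hpn' : (p : ℤ) ∣ n := by exact_mod_cast hpn
  have hpi : Prime (p : ℤ) := Nat.prime_iff_prime_int.mp hp
  refine Padic.isSquare_zmod_of_isQuadNorm (hpn'.trans hnu) (fun h2 ↦ ?_) (fun h2 ↦ ?_) (h p hpn)
  · exact hpi.not_isUnit (hu p (by rwa [← pow_two]))
  · exact hpi.not_isUnit (hcop.isUnit_of_dvd' h2 hpn')

lemma isCoprime_boolSign_mul (s : Bool) (α : ℕ) {k n : ℕ} (hn : Odd n) (hk : k.Coprime n) :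
    IsCoprime (boolSign s * 2 ^ α * k) (n : ℤ) := by
  refine .mul_left (.mul_left ?_ (.pow_left ?_)) (Nat.isCoprime_iff_coprime.mpr hk)
  · cases s
    · exact isCoprime_one_left
    · exact isCoprime_one_left.neg_left
  · exact_mod_cast Nat.isCoprime_iff_coprime.mpr hn.coprime_two_left

lemma Squarefree.exists_eq_boolSign_mul {u : ℤ} (hu : Squarefree u) :
    ∃ (s : Bool) (α : Fin 2) (k : ℕ), Odd k ∧ Squarefree k ∧ u = boolSign s * 2 ^ α.val * k ∧
      (0 < u → s = false) := by
  have hu' : Squarefree u.natAbs := Int.squarefree_natAbs.mpr hu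
  obtain ⟨e, k, hk, he⟩ := Nat.exists_eq_two_pow_mul_odd hu'.ne_zero
  have he2 : e < 2 := by
    by_contra! h2
    have : 2 * 2 ∣ u.natAbs := he ▸ (pow_dvd_pow 2 h2).mul_right k
    exact Nat.prime_two.not_isUnit (hu' 2 this)
  have hks : Squarefree k := hu'.squarefree_of_dvd (he ▸ dvd_mul_left k _)
  have he' : (u.natAbs : ℤ) = 2 ^ e * k := by exact_mod_cast he
  rcases lt_or_ge 0 u with h0 | h0
  · refine ⟨false, ⟨e, he2⟩, k, hk, hks, ?_, fun _ ↦ rfl⟩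
    simp only [boolSign]
    rw [Int.natAbs_of_nonneg h0.le] at he'
    simp [he']
  · refine ⟨true, ⟨e, he2⟩, k, hk, hks, ?_, fun h ↦ absurd h h0.not_gt⟩
    simp only [boolSign]
    rw [Int.ofNat_natAbs_of_nonpos h0] at he'
    simp
    linarith

lemma isSquare_zmod_of_squarefree {t : ℕ} [Fact t.Prime] (ht : t ≠ 2) {u w : ℤ}
    (hu : Squarefree u) (hw : Squarefree w) (htu : ¬ (t : ℤ) ∣ u) (htw : (t : ℤ) ∣ w)
    (hneg : 0 < u ∨ 0 < w)
    (h : ∀ (p : ℕ) [Fact p.Prime], p ≠ t → IsQuadNorm (u : ℚ_[p]) w) : IsSquare (u : ZMod t) := by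
  have htp : t.Prime := Fact.out
  have hto : Odd t := htp.odd_of_ne_two ht
  have hti : Prime (t : ℤ) := Nat.prime_iff_prime_int.mp htp
  obtain ⟨s, α, U, hU, hUs, hsu, hs⟩ := hu.exists_eq_boolSign_mul
  obtain ⟨s', β, W, hW, hWs, hsw, hs'⟩ := hw.exists_eq_boolSign_mul
  have hss : (s && s') = false := by rcases hneg with h0 | h0 <;> simp [hs, hs', h0]
  obtain ⟨m, n, hmn, hm, hn⟩ := Nat.exists_coprime U W
  set g := U.gcd W
  rw [mul_comm] at hm hn
  clear_value g
  subst hm hn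
  obtain ⟨hg, hm⟩ := Nat.odd_mul.mp hU
  have hn := (Nat.odd_mul.mp hW).2
  have hgm := Nat.coprime_of_squarefree_mul hUs
  have hgn := Nat.coprime_of_squarefree_mul hWs
  have hgu : (g : ℤ) ∣ u := ⟨boolSign s * 2 ^ α.val * m, by rw [hsu]; push_cast; ring⟩
  have hmu : (m : ℤ) ∣ u := ⟨boolSign s * 2 ^ α.val * g, by rw [hsu]; push_cast; ring⟩
  have hnw : (n : ℤ) ∣ w := ⟨boolSign s' * 2 ^ β.val * g, by rw [hsw]; push_cast; ring⟩
  have ne_of_dvd {p k : ℕ} (hpk : p ∣ k) (hku : (k : ℤ) ∣ u) : p ≠ t := by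
    rintro rfl
    exact htu ((Int.natCast_dvd_natCast.mpr hpk).trans hku)
  have htn : t ∣ n := by
    have h1 : IsCoprime (boolSign s' * 2 ^ β.val * (1 : ℕ)) (t : ℤ) :=
      isCoprime_boolSign_mul s' β hto (Nat.coprime_one_left t)
    rw [hsw] at htw
    rw [Nat.cast_one, mul_one] at h1
    have := h1.symm.dvd_of_dvd_mul_left htw
    refine (htp.dvd_mul.mp (by exact_mod_cast this)).resolve_left fun h2 ↦ ?_
    exact ne_of_dvd h2 hgu rfl
  have key : J(u | n) = 1 := by
    have h₁ : J(w | m) = 1 := jacobiSym_eq_one_of_isQuadNorm hu hmu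
      (hsw ▸ isCoprime_boolSign_mul s' β hm (hgm.mul_left hmn.symm))
      fun p _ hpm ↦ h p (ne_of_dvd hpm hmu)
    have h₂ : J(boolSign true * boolSign s * boolSign s' * 2 ^ (α.val + β.val) * (m * n) | g) =
        1 := by
      refine jacobiSym_eq_one_of_isQuadNorm hu hgu ?_ fun p _ hpg ↦ ?_
      · have := isCoprime_boolSign_mul (!(s ^^ s')) (α.val + β.val) hg (hgm.symm.mul_left hgn.symm)
        convert this using 2
        · congr 1
          cases s <;> cases s' <;> rfl
        · push_cast
          rfl
      · have hg0 : (g : ℚ_[p]) ≠ 0 := by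
          exact_mod_cast hg.pos.ne'
        have := (IsQuadNorm.neg_self (u : ℚ_[p])).mul (h p (ne_of_dvd hpg hgu))
        rw [← IsQuadNorm.mul_sq_iff hg0]
        convert this using 1
        have : (-u * w : ℤ) = boolSign true * boolSign s * boolSign s' * 2 ^ (α.val + β.val) *
            (m * n) * g ^ 2 := by
          rw [hsu, hsw, show boolSign true = -1 from rfl]
          push_cast
          ring
        exact_mod_cast this.symm
    rw [hsu]
    rw [hsw] at h₁
    push_cast at h₁ ⊢
    refine jacobiSym_eq_one_of_dyadicCond hg hm hn hgm hgn hmn α β s s' hss ?_ h₁ h₂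
    have hodd (s : Bool) {k : ℕ} (hk : Odd k) : Odd (boolSign s * k) := by
      refine .mul ?_ (by exact_mod_cast hk)
      cases s <;> decide
    have := dyadicCond_of_isQuadNorm α β (hodd s hU) (hodd s' hW) (by
      convert h 2 ht.symm using 2
      · rw [hsu]; ring
      · rw [hsw]; ring)
    push_cast [← mul_assoc] at this
    exact this
  obtain ⟨n', rfl⟩ := htn
  have htn' : t.Coprime n' := Nat.coprime_of_squarefree_mul
    (hWs.squarefree_of_dvd (dvd_mul_left _ _))
  have hn' : J(u | n') = 1 := by
    refine jacobiSym_eq_one_of_isQuadNorm hw ((Dvd.intro_left _ (by push_cast; rfl)).trans hnw) ?_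
      fun p _ hp ↦ ?_
    · rw [hsu]
      exact isCoprime_boolSign_mul s α (Nat.odd_mul.mp hn).2
        (hgn.coprime_mul_left_right.mul_left hmn.coprime_mul_left_right)
    · refine (h p ?_).symm (by exact_mod_cast hw.ne_zero)
      rintro rfl
      exact htp.one_lt.ne' (htn'.eq_one_of_dvd hp)
  have : NeZero t := ⟨htp.ne_zero⟩
  have : NeZero n' := ⟨by rintro rfl; simp at hn⟩
  rw [jacobiSym.mul_right, hn', mul_one, ← jacobiSym.legendreSym.to_jacobiSym] at key
  refine (legendreSym.eq_one_iff t fun h0 ↦ htu ?_).mp key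
  exact (ZMod.intCast_zmod_eq_zero_iff_dvd u t).mp h0

lemma Int.exists_squarefree_mul_sq {u : ℤ} (hu : u ≠ 0) :
    ∃ v s : ℤ, Squarefree v ∧ s ≠ 0 ∧ u = v * s ^ 2 := by
  obtain ⟨a, b, ha, hb, h, hsq⟩ := Nat.sq_mul_squarefree_of_pos (Int.natAbs_pos.mpr hu)
  refine ⟨u.sign * a, b, ?_, by exact_mod_cast hb.ne', ?_⟩
  · rw [← Int.squarefree_natAbs, Int.natAbs_mul, Int.natAbs_sign_of_ne_zero hu]
    simpa using hsq
  · have h' : (b : ℤ) ^ 2 * a = |u| := by rw [Int.abs_eq_natAbs, ← h]; push_cast; ring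
    rw [mul_assoc, mul_comm (a : ℤ), h', Int.sign_mul_abs]

/-- If the Hilbert symbols of `u` and `w` are trivial at all places except possibly the odd prime
`t`, then they are trivial at `t`. -/
lemma isSquare_zmod_of_reciprocity {t : ℕ} [Fact t.Prime] (ht : t ≠ 2) {u w : ℤ}
    (hu : u ≠ 0) (hw : w ≠ 0) (htu : ¬ (t : ℤ) ∣ u) (htw : (t : ℤ) ∣ w) (htw2 : ¬ (t : ℤ) ^ 2 ∣ w)
    (hneg : 0 < u ∨ 0 < w)
    (h : ∀ (p : ℕ) [Fact p.Prime], p ≠ t → IsQuadNorm (u : ℚ_[p]) w) : IsSquare (u : ZMod t) := by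
  have hti : Prime (t : ℤ) := Nat.prime_iff_prime_int.mp Fact.out
  obtain ⟨u, r, hu', hr, rfl⟩ := Int.exists_squarefree_mul_sq hu
  obtain ⟨w, s, hw', hs, rfl⟩ := Int.exists_squarefree_mul_sq hw
  have hts : ¬ (t : ℤ) ∣ s := fun h0 ↦ htw2 ((pow_dvd_pow_of_dvd h0 2).mul_left w)
  have hsq : IsSquare (u : ZMod t) := by
    refine isSquare_zmod_of_squarefree ht hu' hw' (fun h0 ↦ htu (h0.mul_right _)) ?_ ?_ ?_
    · exact (hti.dvd_or_dvd htw).resolve_right fun h0 ↦ hts (hti.dvd_of_dvd_pow h0)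
    · exact hneg.imp (pos_of_mul_pos_left · (sq_nonneg r)) (pos_of_mul_pos_left · (sq_nonneg s))
    · intro p _ hp
      have := h p hp
      push_cast at this
      rwa [IsQuadNorm.mul_sq_iff (by exact_mod_cast hs),
        IsQuadNorm.sq_mul_left_iff (by exact_mod_cast hr)] at this
  push_cast
  exact hsq.mul (.sq _)

end Reciprocity

lemma Nat.Prime.mem_of_dvd_prod_pow {S : Finset ℕ} (hS : ∀ q ∈ S, q.Prime) {e : ℕ → ℕ} {p : ℕ}
    (hp : p.Prime) (h : p ∣ ∏ q ∈ S, q ^ e q) : p ∈ S := by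
  obtain ⟨q, hq, hpq⟩ := (hp.prime.dvd_finsetProd_iff _).mp h
  rwa [(Nat.prime_dvd_prime_iff_eq hp (hS q hq)).mp (hp.dvd_of_dvd_pow hpq)]

/-- Dirichlet's theorem provides a negative integer with prescribed square classes at finitely many
primes, which has exactly one further prime factor. -/
lemma exists_prime_isSquare_mul (S : Finset ℕ) (hS : ∀ q ∈ S, q.Prime) (e m : ℕ → ℕ)
    (hm : ∀ q ∈ S, ¬ q ∣ m q) :
    ∃ t : ℕ, t.Prime ∧ t ∉ S ∧ ∀ (q : ℕ) [Fact q.Prime], q ∈ S →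
      IsSquare (((-((∏ l ∈ S, l ^ e l) * t : ℕ) : ℤ) : ℚ_[q]) * ((q ^ e q * m q : ℕ) : ℚ_[q])) := by
  set P : ℕ → ℕ := fun q ↦ (∏ l ∈ S.erase q, l ^ e l) * m q
  have hP (q : ℕ) (hq : q ∈ S) : ¬ q ∣ P q := by
    intro h
    refine ((hS q hq).dvd_mul.mp h).elim (fun h1 ↦ ?_) (hm q hq)
    exact Finset.notMem_erase q S
      ((hS q hq).mem_of_dvd_prod_pow (fun l hl ↦ hS l (Finset.mem_of_mem_erase hl)) h1)
  have hpair : (S : Set ℕ).Pairwise (Function.onFun Nat.Coprime fun q ↦ q ^ 3) := by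
    intro q hq l hl hql
    exact Nat.Coprime.pow _ _ ((Nat.coprime_primes (hS q hq) (hS l hl)).mpr hql)
  obtain ⟨k, hk⟩ := Nat.chineseRemainderOfFinset (fun q ↦ (q ^ 3 - 1) * P q) (fun q ↦ q ^ 3) S
    (fun q hq ↦ (pow_pos (hS q hq).pos 3).ne') hpair
  have hkP (q : ℕ) (hq : q ∈ S) : (q : ℤ) ^ 3 ∣ k + P q := by
    have h1 := (Nat.modEq_iff_dvd.mp (hk q hq).symm)
    have h2 : 1 ≤ q ^ 3 := pow_pos (hS q hq).pos 3
    push_cast [h2] at h1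
    have : (k + P q : ℤ) = (k - (q ^ 3 - 1) * P q) + q ^ 3 * P q := by ring
    rw [this]
    exact dvd_add h1 (dvd_mul_right _ _)
  have hkq (q : ℕ) (hq : q ∈ S) : ¬ q ∣ k := by
    intro h
    refine hP q hq ?_
    have h1 : (q : ℤ) ∣ k + P q := (dvd_pow_self _ three_ne_zero).trans (hkP q hq)
    have h2 : (q : ℤ) ∣ k := by exact_mod_cast h
    exact_mod_cast (dvd_add_right h2).mp h1
  have hcop : k.Coprime (∏ q ∈ S, q ^ 3) := by
    refine Nat.Coprime.prod_right fun q hq ↦ Nat.Coprime.pow_right 3 ?_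
    exact ((hS q hq).coprime_iff_not_dvd.mpr (hkq q hq)).symm
  have hne : (∏ q ∈ S, q ^ 3) ≠ 0 := Finset.prod_ne_zero_iff.mpr fun q hq ↦
    (pow_pos (hS q hq).pos 3).ne'
  obtain ⟨t, -, htp, ht⟩ := Nat.forall_exists_prime_gt_and_modEq 0 hne hcop
  have htk (q : ℕ) (hq : q ∈ S) : (q : ℤ) ^ 3 ∣ t + P q := by
    have h1 : (q ^ 3 : ℕ) ∣ (∏ q ∈ S, q ^ 3) := Finset.dvd_prod_of_mem (fun q ↦ q ^ 3) hq
    have h2 := Nat.modEq_iff_dvd.mp (ht.symm.of_dvd h1)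
    push_cast at h2
    have : (t + P q : ℤ) = (t - k) + (k + P q) := by ring
    rw [this]
    exact dvd_add h2 (hkP q hq)
  refine ⟨t, htp, fun htS ↦ hP t htS ?_, fun q _ hq ↦ ?_⟩
  · have h1 : (t : ℤ) ∣ t + P t := (dvd_pow_self _ three_ne_zero).trans (htk t htS)
    exact_mod_cast (dvd_add_right (dvd_refl _)).mp h1
  · have h1 : IsSquare ((-(P q * t) : ℤ) : ℚ_[q]) := by
      refine Padic.isSquare_intCast_of_pow_three_dvd (r := P q) ?_ ?_
      · exact_mod_cast hP q hq
      · have : ((P q : ℤ) ^ 2 - -(P q * t)) = (t + P q) * P q := by ring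
        rw [this]
        exact (htk q hq).mul_right _
    have h2 : ((-((∏ l ∈ S, l ^ e l) * t : ℕ) : ℤ) : ℚ_[q]) * ((q ^ e q * m q : ℕ) : ℚ_[q]) =
        ((-(P q * t) : ℤ) : ℚ_[q]) * ((q : ℚ_[q]) ^ e q) ^ 2 := by
      rw [← Finset.mul_prod_erase S _ hq]
      simp only [P]
      push_cast
      ring
    rw [h2]
    exact h1.mul (.sq _)

/-- A special case of the local-global principle for the pure part of the norm form of a
quaternion algebra. -/
lemma isPureSquare_rat_of_local_of_neg {a b d : ℤ} (ha : a < 0) (hb : b < 0) (hd : d < 0)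
    (h : ∀ (p : ℕ) [Fact p.Prime], IsPureSquare (a : ℚ_[p]) b d) : IsPureSquare (a : ℚ) b d := by
  have hcast (p : ℕ) [Fact p.Prime] {x : ℤ} (hx : x < 0) : (x : ℚ_[p]) ≠ 0 := by
    exact_mod_cast hx.ne
  have hloc (p : ℕ) : ∃ e m : ℕ, (p.Prime → ¬ p ∣ m) ∧ ∀ [Fact p.Prime], ∀ c : ℚ_[p], c ≠ 0 →
      IsSquare (c * ((p ^ e * m : ℕ) : ℚ_[p])) →
      IsQuadNorm (-(a * b : ℚ_[p])) (a * c) ∧ IsQuadNorm (-(a * b * d : ℚ_[p])) (a * b * c) := by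
    by_cases hp : p.Prime
    swap
    · exact ⟨0, 0, fun h ↦ absurd h hp, fun {h} ↦ absurd h.out hp⟩
    have : Fact p.Prime := ⟨hp⟩
    obtain ⟨c', hc', h₁, h₂⟩ := (h p).exists_common_value (hcast p ha) (hcast p hd)
    obtain ⟨e, m, s, -, -, hm, hs, rfl⟩ := Padic.exists_eq_mul_sq hc'
    refine ⟨e, m, fun _ ↦ hm, fun {_} c hc ⟨r, hr⟩ ↦ ?_⟩
    set M : ℚ_[p] := ((p ^ e * m : ℕ) : ℚ_[p])
    have hM : M ≠ 0 := left_ne_zero_of_mul hc'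
    have hr0 : r ≠ 0 := by
      rintro rfl
      simp [hc, hM] at hr
    rw [← mul_assoc, IsQuadNorm.mul_sq_iff hs] at h₁ h₂
    constructor
    · rw [← IsQuadNorm.mul_sq_iff hM]
      convert h₁.mul_sq r using 1
      linear_combination a * M * hr
    · rw [← IsQuadNorm.mul_sq_iff hM]
      convert h₂.mul_sq r using 1
      linear_combination a * b * M * hr
  choose e m hm hloc using hloc
  set S := (2 * a * b * d).natAbs.primeFactors
  have hS : ∀ q ∈ S, q.Prime := fun q hq ↦ Nat.prime_of_mem_primeFactors hq
  have hab : 0 < a * b := mul_pos_of_neg_of_neg ha hb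
  have hne : (2 * a * b * d).natAbs ≠ 0 := by
    rw [Int.natAbs_ne_zero]
    exact mul_ne_zero (by linarith) hd.ne
  have hnS {p : ℕ} (hp : p.Prime) (hpS : p ∉ S) :
      p ≠ 2 ∧ ¬ (p : ℤ) ∣ a ∧ ¬ (p : ℤ) ∣ b ∧ ¬ (p : ℤ) ∣ d := by
    have hpS : ¬ (p : ℤ) ∣ 2 * a * b * d := fun h0 ↦
      hpS (Nat.mem_primeFactors.mpr ⟨hp, Int.natCast_dvd.mp h0, hne⟩)
    refine ⟨?_, fun h0 ↦ hpS ?_, fun h0 ↦ hpS ?_, fun h0 ↦ hpS (h0.mul_left _)⟩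
    · rintro rfl
      exact hpS ⟨a * b * d, by push_cast; ring⟩
    · exact ((h0.mul_left 2).mul_right b).mul_right d
    · exact (h0.mul_left _).mul_right d
  obtain ⟨t, htp, htS, ht⟩ := exists_prime_isSquare_mul S hS e m fun q hq ↦ hm q (hS q hq)
  have : Fact t.Prime := ⟨htp⟩
  set P := ∏ l ∈ S, l ^ e l
  have hP0 : P ≠ 0 := Finset.prod_ne_zero_iff.mpr fun q hq ↦ (pow_pos (hS q hq).pos _).ne'
  have hPp {p : ℕ} (hp : p.Prime) (hpS : p ∉ S) : ¬ (p : ℤ) ∣ P := fun h0 ↦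
    hpS (hp.mem_of_dvd_prod_pow hS (by exact_mod_cast h0))
  set c : ℤ := -((P * t : ℕ) : ℤ)
  have hc : c < 0 := by
    simp only [c, Left.neg_neg_iff]
    exact_mod_cast Nat.mul_pos (Nat.pos_of_ne_zero hP0) htp.pos
  have hcS {p : ℕ} (hp : p.Prime) (hpS : p ∉ S) (hpt : p ≠ t) : ¬ (p : ℤ) ∣ c := by
    simp only [c, dvd_neg]
    push_cast
    rw [(Nat.prime_iff_prime_int.mp hp).dvd_mul]
    refine not_or_intro (hPp hp hpS) fun h0 ↦ hpt ?_
    exact (Nat.prime_dvd_prime_iff_eq hp htp).mp (by exact_mod_cast h0)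
  obtain ⟨ht2, hta, htb, htd⟩ := hnS htp htS
  have main {u v : ℤ} (hu : ∀ p : ℕ, p.Prime → p ∉ S → ¬ (p : ℤ) ∣ u)
      (hv : ∀ p : ℕ, p.Prime → p ∉ S → ¬ (p : ℤ) ∣ v) (hu0 : u ≠ 0) (hv0 : v ≠ 0)
      (hneg : 0 < u ∨ 0 < v * c)
      (hl : ∀ (p : ℕ) [Fact p.Prime], p ∈ S → IsQuadNorm (u : ℚ_[p]) (v * c : ℤ)) :
      IsQuadNorm (u : ℚ) (v * c : ℤ) := by
    have hnt (p : ℕ) [Fact p.Prime] (hpt : p ≠ t) : IsQuadNorm (u : ℚ_[p]) (v * c : ℤ) := by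
      by_cases hpS : p ∈ S
      · exact hl p hpS
      have hp : p.Prime := Fact.out
      refine Padic.isQuadNorm_of_not_dvd (hnS hp hpS).1 (hu p hp hpS) ?_
      rw [(Nat.prime_iff_prime_int.mp hp).dvd_mul]
      exact not_or_intro (hv p hp hpS) (hcS hp hpS hpt)
    refine isQuadNorm_rat_of_local hu0 (mul_ne_zero hv0 hc.ne) hneg fun p _ _ ↦ ?_
    by_cases hpt : p = t
    swap
    · exact hnt p hpt
    subst hpt
    refine IsQuadNorm.of_isSquare (by exact_mod_cast hu0) ?_ _
    refine Padic.isSquare_intCast_of_zmod ht2 (hu p htp htS) ?_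
    refine isSquare_zmod_of_reciprocity ht2 hu0 (mul_ne_zero hv0 hc.ne) (hu p htp htS) ?_ ?_
      hneg hnt
    · exact Dvd.dvd.mul_left ⟨-(P : ℤ), by simp only [c]; push_cast; ring⟩ v
    · intro h0
      have h1 : (p : ℤ) * p ∣ p * (v * P) := by
        have h1 : v * c = -(p * (v * P)) := by
          simp only [c]
          push_cast
          ring
        rwa [h1, dvd_neg, pow_two] at h0
      have h2 := (mul_dvd_mul_iff_left (by exact_mod_cast htp.ne_zero)).mp h1
      exact ((Nat.prime_iff_prime_int.mp htp).dvd_or_dvd h2).elim (hv p htp htS) (hPp htp htS)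
  have hlc (p : ℕ) [Fact p.Prime] (hpS : p ∈ S) := hloc p c (hcast p hc) (ht p hpS)
  have hmul {x y : ℤ} (hx : ∀ p : ℕ, p.Prime → p ∉ S → ¬ (p : ℤ) ∣ x)
      (hy : ∀ p : ℕ, p.Prime → p ∉ S → ¬ (p : ℤ) ∣ y) (p : ℕ) (hp : p.Prime) (hpS : p ∉ S) :
      ¬ (p : ℤ) ∣ x * y := by
    rw [(Nat.prime_iff_prime_int.mp hp).dvd_mul]
    exact not_or_intro (hx p hp hpS) (hy p hp hpS)
  have hpa := fun (p : ℕ) (hp : p.Prime) (hpS : p ∉ S) ↦ (hnS hp hpS).2.1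
  have hpb := fun (p : ℕ) (hp : p.Prime) (hpS : p ∉ S) ↦ (hnS hp hpS).2.2.1
  have hpd := fun (p : ℕ) (hp : p.Prime) (hpS : p ∉ S) ↦ (hnS hp hpS).2.2.2
  have habd : a * b * d < 0 := mul_neg_of_pos_of_neg hab hd
  refine IsPureSquare.of_common_value (c := (c : ℚ)) (by exact_mod_cast ha.ne)
    (by exact_mod_cast hb.ne) (by exact_mod_cast hc.ne) ?_ ?_
  · have := main (u := -(a * b)) (v := a) (fun p hp hpS ↦ by
      rw [dvd_neg]; exact hmul hpa hpb p hp hpS) hpa (neg_ne_zero.mpr hab.ne') ha.ne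
      (.inr (mul_pos_of_neg_of_neg ha hc)) fun p _ hpS ↦ by exact_mod_cast (hlc p hpS).1
    exact_mod_cast this
  · have := main (u := -(a * b * d)) (v := a * b) (fun p hp hpS ↦ by
      rw [dvd_neg]; exact hmul (hmul hpa hpb) hpd p hp hpS) (hmul hpa hpb)
      (neg_ne_zero.mpr habd.ne) hab.ne'
      (.inl (neg_pos.mpr habd)) fun p _ hpS ↦ by exact_mod_cast (hlc p hpS).2
    exact_mod_cast this

lemma Rat.exists_int_eq_mul_sq (q : ℚ) : ∃ (n : ℤ) (s : ℚ), s ≠ 0 ∧ q = n * s ^ 2 := by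
  have hd : (q.den : ℚ) ≠ 0 := by exact_mod_cast q.den_nz
  refine ⟨q.num * q.den, 1 / q.den, one_div_ne_zero hd, ?_⟩
  nth_rw 1 [← q.num_div_den]
  push_cast
  field_simp

lemma isPureSquare_rat_of_local {a b d : ℚ} (ha : a < 0) (hb : b < 0) (hd : d < 0)
    (h : ∀ (p : ℕ) [Fact p.Prime], IsPureSquare (a : ℚ_[p]) b d) : IsPureSquare a b d := by
  obtain ⟨a, r, hr, rfl⟩ := a.exists_int_eq_mul_sq
  obtain ⟨b, s, hs, rfl⟩ := b.exists_int_eq_mul_sq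
  obtain ⟨d, t, ht, rfl⟩ := d.exists_int_eq_mul_sq
  rw [IsPureSquare.left_mul_sq_iff hr, IsPureSquare.right_mul_sq_iff hs,
    IsPureSquare.mul_sq_iff ht]
  have hneg {n : ℤ} {x : ℚ} (h : n * x ^ 2 < 0) : n < 0 := by
    exact_mod_cast neg_of_mul_neg_left h (sq_nonneg x)
  refine isPureSquare_rat_of_local_of_neg (hneg ha) (hneg hb) (hneg hd) fun p _ ↦ ?_
  have := h p
  push_cast at this
  rwa [IsPureSquare.left_mul_sq_iff (by exact_mod_cast hr),
    IsPureSquare.right_mul_sq_iff (by exact_mod_cast hs),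
    IsPureSquare.mul_sq_iff (by exact_mod_cast ht)] at this

section QuaternionAlgebra

variable {F : Type*} [Field F] {a b : F}

lemma QuaternionAlgebra.not_isSquare_left (h : ∀ x : ℍ[F, a, b], x ≠ 0 → IsUnit x) :
    ¬ IsSquare a := by
  rintro ⟨s, rfl⟩
  have h0 : (⟨s, 1, 0, 0⟩ : ℍ[F, s * s, b]) * ⟨s, -1, 0, 0⟩ = 0 := by
    ext <;> simp
  have hx : (⟨s, 1, 0, 0⟩ : ℍ[F, s * s, b]) ≠ 0 := fun h ↦ one_ne_zero (congrArg (·.imI) h)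
  have := congrArg (·.imI) ((h _ hx).mul_right_eq_zero.mp h0)
  simp at this

lemma QuaternionAlgebra.not_isSquare_right (h : ∀ x : ℍ[F, a, b], x ≠ 0 → IsUnit x) :
    ¬ IsSquare b := by
  rintro ⟨s, rfl⟩
  have h0 : (⟨s, 0, 1, 0⟩ : ℍ[F, a, s * s]) * ⟨s, 0, -1, 0⟩ = 0 := by
    ext <;> simp
  have hx : (⟨s, 0, 1, 0⟩ : ℍ[F, a, s * s]) ≠ 0 := fun h ↦ one_ne_zero (congrArg (·.imJ) h)
  have := congrArg (·.imJ) ((h _ hx).mul_right_eq_zero.mp h0)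
  simp at this

lemma QuaternionAlgebra.isUnit_of_norm_ne_zero (x : ℍ[F, a, b])
    (hx : x.re ^ 2 - a * x.imI ^ 2 - b * x.imJ ^ 2 + a * b * x.imK ^ 2 ≠ 0) : IsUnit x := by
  set N := x.re ^ 2 - a * x.imI ^ 2 - b * x.imJ ^ 2 + a * b * x.imK ^ 2
  have h1 : x * star x = algebraMap F _ N := by
    rw [QuaternionAlgebra.algebraMap_eq]
    ext <;> simp [N] <;> ring
  have h2 : star x * x = algebraMap F _ N := by
    rw [QuaternionAlgebra.algebraMap_eq]
    ext <;> simp [N] <;> ring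
  have hN : algebraMap F ℍ[F, a, b] N * algebraMap F _ N⁻¹ = 1 := by
    rw [← map_mul, mul_inv_cancel₀ hx, map_one]
  have hN' : algebraMap F ℍ[F, a, b] N⁻¹ * algebraMap F _ N = 1 := by
    rw [← map_mul, inv_mul_cancel₀ hx, map_one]
  refine ⟨⟨x, star x * algebraMap F _ N⁻¹, by rw [← mul_assoc, h1, hN], ?_⟩, rfl⟩
  rw [← Algebra.commutes, mul_assoc, h2, hN']

/-- In a quaternion algebra which is not a division ring, every scalar is the square of a pure
quaternion. -/
lemma IsPureSquare.of_not_isUnit [NeZero (2 : F)] (ha : a ≠ 0) (hb : b ≠ 0) {x : ℍ[F, a, b]}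
    (hx : x ≠ 0) (hu : ¬ IsUnit x) (d : F) : IsPureSquare a b d := by
  have hN := not_imp_comm.mp (QuaternionAlgebra.isUnit_of_norm_ne_zero x) hu
  by_cases h0 : x.re = 0
  · refine IsPureSquare.of_isotropic (x := x.imI) (y := x.imJ) (z := x.imK) ha hb ?_ ?_ d
    · rw [h0] at hN
      linear_combination -hN
    · by_contra! h
      exact hx (QuaternionAlgebra.ext h0 h.1 h.2.1 h.2.2)
  have h1 : IsPureSquare a b 1 := by
    rw [← IsPureSquare.mul_sq_iff h0]
    exact ⟨x.imI, x.imJ, x.imK, by linear_combination -hN⟩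
  obtain ⟨c, hc, h₁, h₂⟩ := h1.exists_common_value ha one_ne_zero
  rw [mul_one] at h₂
  have h₃ : IsQuadNorm (-(a * b)) b :=
    IsQuadNorm.of_mul (mul_ne_zero ha hc) h₁ (by convert h₂ using 1; ring)
  have h₄ : IsQuadNorm b a := by
    refine IsQuadNorm.of_mul (neg_ne_zero.mpr hb) (.neg_self b) ?_
    convert h₃.symm hb using 1
    ring
  exact .of_isQuadNorm ha hb (h₄.symm ha) d

end QuaternionAlgebra

lemma not_isSquare_of_irreducible_quadratic {F : Type*} [Field F] [NeZero (2 : F)]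
    {a₁ a₂ : F} (h : Irreducible (X ^ 2 + C a₁ * X + C a₂ : F[X])) :
    ¬ IsSquare ((a₁ / 2) ^ 2 - a₂) := by
  rintro ⟨s, hs⟩
  have h2 : (2 : F) ≠ 0 := two_ne_zero
  have hroot : IsRoot (X ^ 2 + C a₁ * X + C a₂ : F[X]) (s - a₁ / 2) := by
    simp only [IsRoot.def, eval_add, eval_pow, eval_X, eval_mul, eval_C]
    field_simp at hs ⊢
    linear_combination -hs
  have hdeg : (X ^ 2 + C a₁ * X + C a₂ : F[X]).degree = 2 := by
    compute_degree!
  rw [degree_eq_one_of_irreducible_of_root h hroot] at hdeg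
  exact absurd hdeg (by decide)

/-- **(Special case of Swan, Prop. 9.19.)** If the rational quaternion algebra `D = (a,b/ℚ)`
is ramified exactly at `p` and `∞`, then every monic quadratic `x² + a₁x + a₂` over `ℚ`
which is irreducible over `ℚ_p` and over `ℝ` has a root in `D`. -/
theorem quadratic_root_in_quaternion_algebra (p : ℕ) [Fact p.Prime] (a b : ℚ)
    (ha : a ≠ 0) (hb : b ≠ 0)
    (hramR : ∀ x : ℍ[ℝ, (a : ℝ), (b : ℝ)], x ≠ 0 → IsUnit x)
    (hramp : ∀ x : ℍ[ℚ_[p], (a : ℚ_[p]), (b : ℚ_[p])], x ≠ 0 → IsUnit x)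
    (hunram : ∀ (q : ℕ) [Fact q.Prime], q ≠ p →
      ∃ x : ℍ[ℚ_[q], (a : ℚ_[q]), (b : ℚ_[q])], x ≠ 0 ∧ ¬ IsUnit x)
    (a₁ a₂ : ℚ)
    (hirrp : Irreducible ((X ^ 2 + C a₁ * X + C a₂ : ℚ[X]).map (algebraMap ℚ ℚ_[p])))
    (hirrR : Irreducible ((X ^ 2 + C a₁ * X + C a₂ : ℚ[X]).map (algebraMap ℚ ℝ))) :
    ∃ α : ℍ[ℚ, a, b],
      α ^ 2 + algebraMap ℚ ℍ[ℚ, a, b] a₁ * α + algebraMap ℚ ℍ[ℚ, a, b] a₂ = 0 := by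
  have neg_of {x : ℚ} (hx : ¬ IsSquare (x : ℝ)) : x < 0 := by
    by_contra! h
    exact hx (Real.isSquare_iff.mpr (by exact_mod_cast h))
  simp only [Polynomial.map_add, Polynomial.map_mul, Polynomial.map_pow, map_X, map_C,
    eq_ratCast] at hirrp hirrR
  have hd : (a₁ / 2) ^ 2 - a₂ < 0 := neg_of (by
    push_cast
    exact not_isSquare_of_irreducible_quadratic hirrR)
  have hcast (q : ℕ) [Fact q.Prime] {x : ℚ} (hx : x ≠ 0) : (x : ℚ_[q]) ≠ 0 := by
    exact_mod_cast hx
  have key : IsPureSquare a b ((a₁ / 2) ^ 2 - a₂) := by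
    refine isPureSquare_rat_of_local (neg_of (QuaternionAlgebra.not_isSquare_left hramR))
      (neg_of (QuaternionAlgebra.not_isSquare_right hramR)) hd fun q _ ↦ ?_
    by_cases hq : q = p
    · subst hq
      refine Padic.isPureSquare_of_not_isSquare (hcast q ha) (hcast q hb) (hcast q hd.ne) ?_
      push_cast
      exact not_isSquare_of_irreducible_quadratic hirrp
    · obtain ⟨x, hx, hu⟩ := hunram q hq
      exact .of_not_isUnit (hcast q ha) (hcast q hb) hx hu _
  obtain ⟨x, y, z, h⟩ := key
  refine ⟨⟨-(a₁ / 2), x, y, z⟩, ?_⟩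
  ext <;> simp [pow_two]
  · linear_combination h
  all_goals ring
end

section
/- Every maximal order of the rational quaternion algebra ℍ[ℚ] is conjugate to the Hurwitz order: if O' is a subring of ℍ[ℚ] which contains ℤ, is finitely generated as a ℤ-module, spans ℍ[ℚ] over ℚ, and is maximal with respect to inclusion among subrings with these properties, then there exists a nonzero y ∈ ℍ[ℚ] such that y⁻¹ O' y equals the Hurwitz order O. -/
open Quaternion

/-- The Hurwitz quaternions: the subring of `ℍ[ℚ]` generated by `i`, `j` and
`ω = (1 + i + j + k)/2`. -/
noncomputable def HurwitzOrder : Subring ℍ[ℚ] :=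
  Subring.closure {(⟨0, 1, 0, 0⟩ : ℍ[ℚ]), ⟨0, 0, 1, 0⟩, ⟨1/2, 1/2, 1/2, 1/2⟩}

/-- A maximal order of `ℍ[ℚ]`: a subring containing `ℤ`, finitely generated as a
`ℤ`-module, spanning `ℍ[ℚ]` over `ℚ`, and maximal among such subrings. -/
def IsMaximalOrder (S : Subring ℍ[ℚ]) : Prop :=
  ((∀ m : ℤ, (m : ℍ[ℚ]) ∈ S) ∧
    (∃ s : Finset ℍ[ℚ], (Submodule.span ℤ (s : Set ℍ[ℚ]) : Set ℍ[ℚ]) = (S : Set ℍ[ℚ])) ∧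
    Submodule.span ℚ (S : Set ℍ[ℚ]) = ⊤) ∧
  ∀ T : Subring ℍ[ℚ],
    ((∀ m : ℤ, (m : ℍ[ℚ]) ∈ T) ∧
      (∃ t : Finset ℍ[ℚ], (Submodule.span ℤ (t : Set ℍ[ℚ]) : Set ℍ[ℚ]) = (T : Set ℍ[ℚ])) ∧
      Submodule.span ℚ (T : Set ℍ[ℚ]) = ⊤) →
    S ≤ T → T = S

theorem exists_hurwitzOrder_coords (x : ℍ[ℚ]) (hx : x ∈ HurwitzOrder) :
    ∃ a b c d : ℤ, x.re = a / 2 ∧ x.imI = a / 2 + b ∧ x.imJ = a / 2 + c ∧ x.imK = a / 2 + d := by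
  induction hx using Subring.closure_induction with
  | mem x hx =>
    rcases hx with rfl | rfl | rfl
    · exact ⟨0, 1, 0, 0, by norm_num⟩
    · exact ⟨0, 0, 1, 0, by norm_num⟩
    · exact ⟨1, 0, 0, 0, by norm_num⟩
  | zero => exact ⟨0, 0, 0, 0, by simp⟩
  | one => exact ⟨2, -1, -1, -1, by simp⟩
  | add x y _ _ hx hy =>
    obtain ⟨a, b, c, d, h0, h1, h2, h3⟩ := hx
    obtain ⟨a', b', c', d', h0', h1', h2', h3'⟩ := hy
    refine ⟨a + a', b + b', c + c', d + d', ?_, ?_, ?_, ?_⟩ <;>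
      simp [h0, h1, h2, h3, h0', h1', h2', h3'] <;> ring
  | neg x _ hx =>
    obtain ⟨a, b, c, d, h0, h1, h2, h3⟩ := hx
    refine ⟨-a, -b, -c, -d, ?_, ?_, ?_, ?_⟩ <;> simp [h0, h1, h2, h3] <;> ring
  | mul x y _ _ hx hy =>
    obtain ⟨a, b, c, d, h0, h1, h2, h3⟩ := hx
    obtain ⟨a', b', c', d', h0', h1', h2', h3'⟩ := hy
    refine ⟨-a * a' - (a * b' + b * a' + a * c' + c * a' + a * d' + d * a')
        - 2 * (b * b' + c * c' + d * d'),
      a * a' + a * b' + b * a' + a * d' + c * a' + c * d' - d * c' + (b * b' + c * c' + d * d'),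
      a * a' + a * c' + c * a' + a * b' + d * a' + d * b' - b * d' + (b * b' + c * c' + d * d'),
      a * a' + a * d' + d * a' + a * c' + b * a' + b * c' - c * b' + (b * b' + c * c' + d * d'),
      ?_, ?_, ?_, ?_⟩ <;>
    simp only [Quaternion.re_mul, Quaternion.imI_mul, Quaternion.imJ_mul, Quaternion.imK_mul,
      h0, h1, h2, h3, h0', h1', h2', h3'] <;> push_cast <;> ring

theorem exists_hurwitzOrder_basis :
    ∃ ω ∈ HurwitzOrder, ∃ i ∈ HurwitzOrder, ∃ j ∈ HurwitzOrder, ∃ k ∈ HurwitzOrder,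
      ∀ (x : ℍ[ℚ]) (a b c d : ℤ), x.re = a / 2 → x.imI = a / 2 + b → x.imJ = a / 2 + c →
        x.imK = a / 2 + d → x = a • ω + b • i + c • j + d • k := by
  have hi : (⟨0, 1, 0, 0⟩ : ℍ[ℚ]) ∈ HurwitzOrder := Subring.subset_closure (Or.inl rfl)
  have hj : (⟨0, 0, 1, 0⟩ : ℍ[ℚ]) ∈ HurwitzOrder := Subring.subset_closure (Or.inr (Or.inl rfl))
  have hω : (⟨1 / 2, 1 / 2, 1 / 2, 1 / 2⟩ : ℍ[ℚ]) ∈ HurwitzOrder :=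
    Subring.subset_closure (Or.inr (Or.inr rfl))
  obtain ⟨i, hi, i0, i1, i2, i3⟩ : ∃ i ∈ HurwitzOrder, i.re = 0 ∧ i.imI = 1 ∧ i.imJ = 0 ∧
    i.imK = 0 := ⟨_, hi, rfl, rfl, rfl, rfl⟩
  obtain ⟨j, hj, j0, j1, j2, j3⟩ : ∃ j ∈ HurwitzOrder, j.re = 0 ∧ j.imI = 0 ∧ j.imJ = 1 ∧
    j.imK = 0 := ⟨_, hj, rfl, rfl, rfl, rfl⟩
  obtain ⟨ω, hω, w0, w1, w2, w3⟩ : ∃ ω ∈ HurwitzOrder, ω.re = 1 / 2 ∧ ω.imI = 1 / 2 ∧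
    ω.imJ = 1 / 2 ∧ ω.imK = 1 / 2 := ⟨_, hω, rfl, rfl, rfl, rfl⟩
  refine ⟨ω, hω, i, hi, j, hj, i * j, mul_mem hi hj, fun x a b c d h0 h1 h2 h3 => ?_⟩
  apply Quaternion.ext <;>
    simp [Quaternion.re_mul, Quaternion.imI_mul, Quaternion.imJ_mul, Quaternion.imK_mul,
      h0, h1, h2, h3, i0, i1, i2, i3, j0, j1, j2, j3, w0, w1, w2, w3] <;> ring

theorem mem_hurwitzOrder_iff {x : ℍ[ℚ]} :
    x ∈ HurwitzOrder ↔ ∃ a b c d : ℤ,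
      x.re = a / 2 ∧ x.imI = a / 2 + b ∧ x.imJ = a / 2 + c ∧ x.imK = a / 2 + d := by
  refine ⟨exists_hurwitzOrder_coords x, ?_⟩
  rintro ⟨a, b, c, d, h0, h1, h2, h3⟩
  obtain ⟨ω, hω, i, hi, j, hj, k, hk, h⟩ := exists_hurwitzOrder_basis
  rw [h x a b c d h0 h1 h2 h3]
  exact add_mem (add_mem (add_mem (zsmul_mem hω a) (zsmul_mem hi b)) (zsmul_mem hj c))
    (zsmul_mem hk d)

theorem exists_nat_normSq_of_mem_hurwitzOrder {x : ℍ[ℚ]} (hx : x ∈ HurwitzOrder) :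
    ∃ n : ℕ, normSq x = n := by
  obtain ⟨a, b, c, d, h0, h1, h2, h3⟩ := mem_hurwitzOrder_iff.1 hx
  have h : normSq x = ((a ^ 2 + a * (b + c + d) + b ^ 2 + c ^ 2 + d ^ 2 : ℤ) : ℚ) := by
    rw [Quaternion.normSq_def', h0, h1, h2, h3]
    push_cast
    ring
  have hpos := h ▸ Quaternion.normSq_nonneg (a := x)
  obtain ⟨n, hn⟩ := Int.eq_ofNat_of_zero_le (Int.cast_nonneg_iff.1 hpos)
  exact ⟨n, by rw [h, hn]; simp⟩

theorem exists_hurwitzOrder_normSq_sub_lt_one (x : ℍ[ℚ]) :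
    ∃ q ∈ HurwitzOrder, normSq (x - q) < 1 := by
  set a : ℤ := round (2 * x.re)
  obtain ⟨q, q0, q1, q2, q3⟩ : ∃ q : ℍ[ℚ], q.re = a / 2 ∧
      q.imI = a / 2 + round (x.imI - a / 2) ∧ q.imJ = a / 2 + round (x.imJ - a / 2) ∧
      q.imK = a / 2 + round (x.imK - a / 2) := ⟨⟨_, _, _, _⟩, rfl, rfl, rfl, rfl⟩
  refine ⟨q, mem_hurwitzOrder_iff.2 ⟨a, _, _, _, q0, q1, q2, q3⟩, ?_⟩
  have h0 := abs_le.1 (abs_sub_round (2 * x.re))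
  have h1 := abs_le.1 (abs_sub_round (x.imI - a / 2))
  have h2 := abs_le.1 (abs_sub_round (x.imJ - a / 2))
  have h3 := abs_le.1 (abs_sub_round (x.imK - a / 2))
  rw [Quaternion.normSq_def']
  simp only [Quaternion.re_sub, Quaternion.imI_sub, Quaternion.imJ_sub, Quaternion.imK_sub,
    q0, q1, q2, q3]
  have e0 : (x.re - a / 2) ^ 2 ≤ (1 / 4) ^ 2 := sq_le_sq' (by linarith) (by linarith)
  have e1 := sq_le_sq' h1.1 h1.2
  have e2 := sq_le_sq' h2.1 h2.2
  have e3 := sq_le_sq' h3.1 h3.2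
  simp only [sub_sub] at e1 e2 e3
  linarith

theorem exists_int_mul_mem_hurwitzOrder (x : ℍ[ℚ]) :
    ∃ N : ℤ, N ≠ 0 ∧ (N : ℍ[ℚ]) * x ∈ HurwitzOrder := by
  obtain ⟨⟨N, hN⟩, h⟩ := IsLocalization.exist_integer_multiples_of_finset (nonZeroDivisors ℤ)
    ({x.re, x.imI, x.imJ, x.imK} : Finset ℚ)
  simp only [Finset.mem_insert, Finset.mem_singleton, forall_eq_or_imp, forall_eq] at h
  obtain ⟨⟨a, ha⟩, ⟨b, hb⟩, ⟨c, hc⟩, ⟨d, hd⟩⟩ := h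
  refine ⟨N, nonZeroDivisors.ne_zero hN,
    mem_hurwitzOrder_iff.2 ⟨2 * a, b - a, c - a, d - a, ?_⟩⟩
  simp only [eq_intCast, zsmul_eq_mul] at ha hb hc hd
  rw [← Quaternion.coe_intCast, Quaternion.coe_mul_eq_smul]
  simp [ha, hb, hc, hd]

theorem exists_int_mul_mem_hurwitzOrder_of_finset (s : Finset ℍ[ℚ]) :
    ∃ N : ℤ, N ≠ 0 ∧ ∀ x ∈ Submodule.span ℤ (s : Set ℍ[ℚ]), (N : ℍ[ℚ]) * x ∈ HurwitzOrder := by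
  choose f hf0 hf using exists_int_mul_mem_hurwitzOrder
  refine ⟨∏ x ∈ s, f x, Finset.prod_ne_zero_iff.2 fun x _ => hf0 x, fun x hx => ?_⟩
  induction hx using Submodule.span_induction with
  | mem x hx =>
    obtain ⟨m, hm⟩ := Finset.dvd_prod_of_mem f (Finset.mem_coe.1 hx)
    rw [hm, mul_comm, Int.cast_mul, mul_assoc]
    exact mul_mem (intCast_mem _ m) (hf x)
  | zero => simp
  | add x y _ _ hx hy => rw [mul_add]; exact add_mem hx hy
  | smul a x _ hx => rw [mul_smul_comm]; exact zsmul_mem hx a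

/-- A nonzero fractional left ideal of the Hurwitz order is principal. -/
theorem exists_generator_of_hurwitzOrder_ideal (I : AddSubgroup ℍ[ℚ])
    (hI : ∀ a ∈ HurwitzOrder, ∀ x ∈ I, a * x ∈ I) (hI0 : ∃ x ∈ I, x ≠ 0)
    {N : ℤ} (hN : N ≠ 0) (hNI : ∀ x ∈ I, (N : ℍ[ℚ]) * x ∈ HurwitzOrder) :
    ∃ y ∈ I, y ≠ 0 ∧ ∀ x ∈ I, ∃ a ∈ HurwitzOrder, x = a * y := by
  classical
  have hex : ∃ n : ℕ, ∃ x ∈ I, x ≠ 0 ∧ normSq ((N : ℍ[ℚ]) * x) = n := by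
    obtain ⟨x, hx, hx0⟩ := hI0
    obtain ⟨n, hn⟩ := exists_nat_normSq_of_mem_hurwitzOrder (hNI x hx)
    exact ⟨n, x, hx, hx0, hn⟩
  obtain ⟨y, hy, hy0, hny⟩ := Nat.find_spec hex
  refine ⟨y, hy, hy0, fun x hx => ?_⟩
  obtain ⟨q, hq, hlt⟩ := exists_hurwitzOrder_normSq_sub_lt_one (x * y⁻¹)
  refine ⟨q, hq, ?_⟩
  by_contra hne
  have hz : x - q * y ∈ I := sub_mem hx (hI q hq y hy)
  obtain ⟨n, hn⟩ := exists_nat_normSq_of_mem_hurwitzOrder (hNI _ hz)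
  refine Nat.find_min hex (m := n) ?_ ⟨_, hz, sub_ne_zero.2 hne, hn⟩
  have hmul : (N : ℍ[ℚ]) * (x - q * y) = N * ((x * y⁻¹ - q) * y) := by
    rw [sub_mul, inv_mul_cancel_right₀ hy0]
  have hN0 : (N : ℍ[ℚ]) ≠ 0 := by
    rw [← Quaternion.coe_intCast]
    exact fun h => hN (by exact_mod_cast Quaternion.coe_injective h)
  rw [← Nat.cast_lt (α := ℚ), ← hn, ← hny, hmul, map_mul, map_mul, map_mul]
  have h1 : 0 < normSq (N : ℍ[ℚ]) :=
    lt_of_le_of_ne Quaternion.normSq_nonneg (Quaternion.normSq_ne_zero.2 hN0).symm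
  have h2 : 0 < normSq y :=
    lt_of_le_of_ne Quaternion.normSq_nonneg (Quaternion.normSq_ne_zero.2 hy0).symm
  exact mul_lt_mul_of_pos_left (mul_lt_of_lt_one_left h2 hlt) h1

/-- A finitely generated subring of the rational quaternions conjugates into the Hurwitz order. -/
theorem exists_conj_mem_hurwitzOrder (S : Subring ℍ[ℚ]) (s : Finset ℍ[ℚ])
    (hs : (Submodule.span ℤ (s : Set ℍ[ℚ]) : Set ℍ[ℚ]) = (S : Set ℍ[ℚ])) :
    ∃ y : ℍ[ℚ], y ≠ 0 ∧ ∀ x ∈ S, y * x * y⁻¹ ∈ HurwitzOrder := by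
  obtain ⟨N, hN, hNs⟩ := exists_int_mul_mem_hurwitzOrder_of_finset s
  set P := AddSubgroup.toIntSubmodule HurwitzOrder.toAddSubgroup with hP
  set Q := AddSubgroup.toIntSubmodule S.toAddSubgroup with hQ
  have hPP : P * P ≤ P := Submodule.mul_le.2 fun a ha b hb => HurwitzOrder.mul_mem ha hb
  have hQQ : Q * Q ≤ Q := Submodule.mul_le.2 fun a ha b hb => S.mul_mem ha hb
  have hleft : ∀ a ∈ HurwitzOrder, ∀ x ∈ P * Q, a * x ∈ P * Q := fun a ha x hx => by
    have h : a * x ∈ P * (P * Q) := Submodule.mul_mem_mul ha hx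
    rw [← mul_assoc] at h
    exact mul_le_mul' hPP le_rfl h
  have hright : ∀ x ∈ P * Q, ∀ b ∈ S, x * b ∈ P * Q := fun x hx b hb => by
    have h : x * b ∈ P * Q * Q := Submodule.mul_mem_mul hx hb
    rw [mul_assoc] at h
    exact mul_le_mul' le_rfl hQQ h
  have hone : (1 : ℍ[ℚ]) ∈ P * Q := by
    simpa using Submodule.mul_mem_mul (M := P) (N := Q) HurwitzOrder.one_mem S.one_mem
  have hNI : ∀ x ∈ P * Q, (N : ℍ[ℚ]) * x ∈ HurwitzOrder := fun x hx => by
    induction hx using Submodule.mul_induction_on' with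
    | mem_mul_mem a ha b hb =>
      rw [← mul_assoc, (Int.cast_commute N a).eq, mul_assoc]
      refine mul_mem ha (hNs b ?_)
      rw [← SetLike.mem_coe, hs]
      exact hb
    | add x _ y _ hx hy => rw [mul_add]; exact add_mem hx hy
  obtain ⟨y, hy, hy0, hgen⟩ := exists_generator_of_hurwitzOrder_ideal (P * Q).toAddSubgroup
    hleft ⟨1, hone, one_ne_zero⟩ hN hNI
  refine ⟨y, hy0, fun x hx => ?_⟩
  obtain ⟨a, ha, hax⟩ := hgen (y * x) (hright y hy x hx)
  rwa [hax, mul_inv_cancel_right₀ hy0]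

/-- Conjugation `x ↦ y * x * y⁻¹` by a nonzero element of a division ring. -/
def conjRingHom {D : Type*} [DivisionRing D] (y : D) (hy : y ≠ 0) : D →+* D where
  toFun x := y * x * y⁻¹
  map_one' := by simp [hy]
  map_zero' := by simp
  map_add' a b := by rw [mul_add, add_mul]
  map_mul' a b := by simp [mul_assoc, hy]

theorem exists_finset_span_comap_conjRingHom (y : ℍ[ℚ]) (hy : y ≠ 0) :
    ∃ t : Finset ℍ[ℚ], (Submodule.span ℤ (t : Set ℍ[ℚ]) : Set ℍ[ℚ]) =
      (HurwitzOrder.comap (conjRingHom y hy) : Set ℍ[ℚ]) := by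
  classical
  obtain ⟨ω, hω, i, hi, j, hj, k, hk, hbasis⟩ := exists_hurwitzOrder_basis
  refine ⟨({ω, i, j, k} : Finset ℍ[ℚ]).image fun x => y⁻¹ * x * y, Set.Subset.antisymm ?_ ?_⟩
  · suffices h : Submodule.span ℤ ((({ω, i, j, k} : Finset ℍ[ℚ]).image
        fun x => y⁻¹ * x * y : Finset ℍ[ℚ]) : Set ℍ[ℚ]) ≤ AddSubgroup.toIntSubmodule
          (HurwitzOrder.comap (conjRingHom y hy)).toAddSubgroup from h
    refine Submodule.span_le.2 fun z hz => ?_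
    obtain ⟨x, hx, rfl⟩ := Finset.mem_image.1 (Finset.mem_coe.1 hz)
    change y * (y⁻¹ * x * y) * y⁻¹ ∈ HurwitzOrder
    rw [mul_assoc y⁻¹, mul_inv_cancel_left₀ hy, mul_inv_cancel_right₀ hy]
    simp only [Finset.mem_insert, Finset.mem_singleton] at hx
    rcases hx with rfl | rfl | rfl | rfl <;> assumption
  · intro z hz
    obtain ⟨a, b, c, d, h0, h1, h2, h3⟩ :=
      mem_hurwitzOrder_iff.1 (show y * z * y⁻¹ ∈ HurwitzOrder from hz)
    have h' := hbasis _ a b c d h0 h1 h2 h3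
    have hz' : z = a • (y⁻¹ * ω * y) + b • (y⁻¹ * i * y) + c • (y⁻¹ * j * y)
        + d • (y⁻¹ * k * y) := by
      calc z = y⁻¹ * (y * z * y⁻¹) * y := by simp [mul_assoc, hy]
        _ = _ := by rw [h']; simp only [mul_add, add_mul, mul_smul_comm, smul_mul_assoc]
    rw [hz']
    refine add_mem (add_mem (add_mem ?_ ?_) ?_) ?_ <;>
      exact Submodule.smul_mem _ _ (Submodule.subset_span (Finset.mem_coe.2
        (Finset.mem_image_of_mem _ (by simp))))

/-- Every maximal order of the rational quaternions is conjugate to the Hurwitz order. -/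
theorem maximal_order_conjugate_to_hurwitz (O' : Subring ℍ[ℚ]) (hO' : IsMaximalOrder O') :
    ∃ y : ℍ[ℚ], y ≠ 0 ∧
      (fun x => y⁻¹ * x * y) '' (O' : Set ℍ[ℚ]) = (HurwitzOrder : Set ℍ[ℚ]) := by
  obtain ⟨⟨-, ⟨s, hs⟩, hspan⟩, hmax⟩ := hO'
  obtain ⟨y, hy, hconj⟩ := exists_conj_mem_hurwitzOrder O' s hs
  have hle : O' ≤ HurwitzOrder.comap (conjRingHom y hy) := hconj
  have heq : HurwitzOrder.comap (conjRingHom y hy) = O' :=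
    hmax _ ⟨fun m => intCast_mem _ m, exists_finset_span_comap_conjRingHom y hy,
      top_le_iff.1 (hspan ▸ Submodule.span_mono hle)⟩ hle
  refine ⟨y⁻¹, inv_ne_zero hy, Set.Subset.antisymm ?_ fun z hz => ?_⟩
  · rintro _ ⟨x, hx, rfl⟩
    simpa only [inv_inv, SetLike.mem_coe] using hconj x hx
  · have hyz : y * (y⁻¹ * z * y) * y⁻¹ = z := by simp [mul_assoc, hy]
    refine ⟨y⁻¹ * z * y, ?_, by simpa only [inv_inv] using hyz⟩
    rw [← heq]
    change y * (y⁻¹ * z * y) * y⁻¹ ∈ HurwitzOrder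
    rwa [hyz]
end

section
/- Let ℓ ≥ 2 be an odd integer. Let O' be a subring of ℍ[ℚ] which contains ℤ[1/ℓ], is finitely generated as a ℤ[1/ℓ]-module, spans ℍ[ℚ] over ℚ, and is maximal with respect to inclusion among subrings with these properties (a maximal ℤ[1/ℓ]-order). Then for every x' ∈ O' there exists an element x ∈ O[1/ℓ] with the same minimal polynomial as x'; equivalently, with re(x) = re(x') and normSq(x) = normSq(x'). -/
open Quaternion

/-- `O[1/ℓ]`: the subring of `ℍ[ℚ]` generated by the Hurwitz order and `1/ℓ`. -/
noncomputable def HurwitzOrderInvLoc (ℓ : ℕ) : Subring ℍ[ℚ] :=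
  Subring.closure ((HurwitzOrder : Set ℍ[ℚ]) ∪ {((ℓ : ℚ)⁻¹ : ℚ) • (1 : ℍ[ℚ])})

/-- `ℤ[1/ℓ]` as a subring of `ℚ`. -/
noncomputable def ZInvLoc (ℓ : ℕ) : Subring ℚ :=
  Subring.closure {((ℓ : ℚ)⁻¹ : ℚ)}

/-- The Davenport–Cassels argument for sums of three squares, with an integral denominator `t`. -/
theorem exists_int_sum_three_sq_of_sq_mul {D : ℤ} {t : ℕ} (ht : 0 < t) {x y z : ℤ}
    (h : x ^ 2 + y ^ 2 + z ^ 2 = D * (t : ℤ) ^ 2) :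
    ∃ a b c : ℤ, a ^ 2 + b ^ 2 + c ^ 2 = D := by
  induction t using Nat.strong_induction_on generalizing x y z with
  | _ t ih =>
  have near : ∀ x : ℤ, ∃ a r : ℤ, x = t * a + r ∧ 4 * r ^ 2 ≤ (t:ℤ) ^ 2 := by
    intro x
    refine ⟨x.bdiv t, x.bmod t, (Int.bdiv_add_bmod x t).symm, ?_⟩
    have h1 := Int.le_bmod (x := x) (m := t) (by omega)
    have h2 := Int.bmod_le (x := x) (m := t) (by omega)
    have h3 : -(t:ℤ) ≤ 2 * x.bmod t := by omega
    have h4 : 2 * x.bmod t ≤ t := by omega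
    linarith [sq_le_sq' h3 h4, mul_pow 2 (x.bmod t) 2]
  obtain ⟨a, r, hx, hr⟩ := near x
  obtain ⟨b, s, hy, hs⟩ := near y
  obtain ⟨c, u, hz, hu⟩ := near z
  have ht' : (0:ℤ) < t := by exact_mod_cast ht
  set A : ℤ := a ^ 2+b ^ 2+c ^ 2 - D with hA
  set B : ℤ := 2 * (D * t - (x*a+y*b+z*c)) with hB
  have key : (t:ℤ) * (A * t + B) = r ^ 2+s ^ 2+u ^ 2 := by
    have : r = x - t*a := by linarith
    have : s = y - t*b := by linarith
    have : u = z - t*c := by linarith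
    subst r s u
    rw [hA, hB]; linear_combination -h
  have hnorm : (A*x+B*a) ^ 2+(A*y+B*b) ^ 2+(A*z+B*c) ^ 2 = D * (A*t+B) ^ 2 := by
    have hb : 2*(x*a+y*b+z*c) = 2*D*t - B := by rw [hB]; ring
    have ha : a ^ 2+b ^ 2+c ^ 2 = D + A := by rw [hA]; ring
    linear_combination A ^ 2 * h + A*B*hb + B ^ 2 * ha
  by_cases h0 : r ^ 2+s ^ 2+u ^ 2 = 0
  · have : r = 0 := pow_eq_zero_iff (two_ne_zero) |>.mp
      (by linarith [sq_nonneg r, sq_nonneg s, sq_nonneg u] : r ^ 2 = 0)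
    have : s = 0 := pow_eq_zero_iff (two_ne_zero) |>.mp
      (by linarith [sq_nonneg r, sq_nonneg s, sq_nonneg u] : s ^ 2 = 0)
    have : u = 0 := pow_eq_zero_iff (two_ne_zero) |>.mp
      (by linarith [sq_nonneg r, sq_nonneg s, sq_nonneg u] : u ^ 2 = 0)
    subst r s u
    refine ⟨a, b, c, ?_⟩
    have : (t:ℤ) ^ 2 ≠ 0 := by positivity
    apply mul_right_cancel₀ this
    rw [← h, hx, hy, hz]; ring
  · have hpos : 0 < r ^ 2+s ^ 2+u ^ 2 := lt_of_le_of_ne (by positivity) (Ne.symm h0)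
    have hp : 0 < A * t + B := pos_of_mul_pos_right (key ▸ hpos) ht'.le
    have hlt : A * t + B < t := by
      refine lt_of_mul_lt_mul_left ?_ ht'.le
      have : (0 : ℤ) < (t : ℤ) ^ 2 := by positivity
      linarith
    obtain ⟨t', e⟩ := Int.eq_ofNat_of_zero_le hp.le
    rw [e] at hnorm hp hlt
    exact ih t' (by exact_mod_cast hlt) (by exact_mod_cast hp) hnorm

/-- A sum of three rational squares that is an integer is a sum of three integer squares. -/
theorem exists_int_sum_three_sq_of_rat {D : ℤ} {x y z : ℚ} (h : x ^ 2 + y ^ 2 + z ^ 2 = D) :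
    ∃ a b c : ℤ, a ^ 2 + b ^ 2 + c ^ 2 = D := by
  refine exists_int_sum_three_sq_of_sq_mul (t := x.den * y.den * z.den)
    (x := x.num * y.den * z.den) (y := y.num * x.den * z.den) (z := z.num * x.den * y.den)
    (by positivity) ?_
  have hx := Rat.mul_den_eq_num x
  have hy := Rat.mul_den_eq_num y
  have hz := Rat.mul_den_eq_num z
  have : ((x.num : ℚ) * y.den * z.den) ^ 2 + (y.num * x.den * z.den) ^ 2
      + (z.num * x.den * y.den) ^ 2 = D * (x.den * y.den * z.den) ^ 2 := by
    rw [← hx, ← hy, ← hz, ← h]; ring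
  exact_mod_cast this

/-- If `4n - t²` is a sum of three rational squares, then the Hurwitz order contains an element of
reduced trace `t` and reduced norm `n`. -/
theorem exists_mem_hurwitzOrder {t n : ℤ} {x y z : ℚ}
    (h : x ^ 2 + y ^ 2 + z ^ 2 = 4 * n - t ^ 2) :
    ∃ q ∈ HurwitzOrder, 2 * q.re = t ∧ normSq q = n := by
  obtain ⟨a, b, c, habc⟩ := exists_int_sum_three_sq_of_rat (D := 4 * n - t ^ 2)
    (by exact_mod_cast h)
  have sq_mod (m : ℤ) : ∃ s, m ^ 2 = 4 * s + m % 2 := by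
    obtain ⟨s, e | e⟩ := m.even_or_odd'
    · exact ⟨s ^ 2, by rw [e]; simp; ring⟩
    · exact ⟨s ^ 2 + s, by rw [e]; simp [Int.add_emod]; ring⟩
  obtain ⟨a₁, ha⟩ := sq_mod a
  obtain ⟨b₁, hb⟩ := sq_mod b
  obtain ⟨c₁, hc⟩ := sq_mod c
  obtain ⟨t₁, ht⟩ := sq_mod t
  obtain ⟨a', ha'⟩ : ∃ a', a = 2 * a' + t % 2 := ⟨a / 2, by omega⟩
  obtain ⟨b', hb'⟩ : ∃ b', b = 2 * b' + t % 2 := ⟨b / 2, by omega⟩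
  obtain ⟨c', hc'⟩ : ∃ c', c = 2 * c' + t % 2 := ⟨c / 2, by omega⟩
  obtain ⟨t', ht'⟩ : ∃ t', t = 2 * t' + t % 2 := ⟨t / 2, by omega⟩
  generalize t % 2 = e at *
  obtain ⟨i, hi, hi₀, hi₁, hi₂, hi₃⟩ : ∃ i ∈ HurwitzOrder,
      i.re = 0 ∧ i.imI = 1 ∧ i.imJ = 0 ∧ i.imK = 0 :=
    ⟨⟨0, 1, 0, 0⟩, Subring.subset_closure (Or.inl rfl), rfl, rfl, rfl, rfl⟩
  obtain ⟨j, hj, hj₀, hj₁, hj₂, hj₃⟩ : ∃ j ∈ HurwitzOrder,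
      j.re = 0 ∧ j.imI = 0 ∧ j.imJ = 1 ∧ j.imK = 0 :=
    ⟨⟨0, 0, 1, 0⟩, Subring.subset_closure (Or.inr (Or.inl rfl)), rfl, rfl, rfl, rfl⟩
  obtain ⟨ω, hω, hω₀, hω₁, hω₂, hω₃⟩ : ∃ ω ∈ HurwitzOrder,
      ω.re = 1 / 2 ∧ ω.imI = 1 / 2 ∧ ω.imJ = 1 / 2 ∧ ω.imK = 1 / 2 :=
    ⟨⟨1/2, 1/2, 1/2, 1/2⟩, Subring.subset_closure (Or.inr (Or.inr rfl)), rfl, rfl, rfl, rfl⟩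
  have hq := add_mem (add_mem (add_mem (add_mem
    (zsmul_mem (one_mem HurwitzOrder) t') (zsmul_mem hi a')) (zsmul_mem hj b'))
    (zsmul_mem (mul_mem hi hj) c')) (zsmul_mem hω e)
  refine ⟨_, hq, ?_, ?_⟩
  · rw [ht']
    simp [hi₀, hj₀, hω₀, hi₁, hj₁, hi₂, hj₂, hi₃, hj₃, -zsmul_eq_mul]
    ring
  · have hn : (4 * n : ℚ) = a ^ 2 + b ^ 2 + c ^ 2 + t ^ 2 := by exact_mod_cast by linarith
    rw [ha', hb', hc', ht'] at hn
    push_cast at hn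
    simp [normSq_def', hi₀, hj₀, hω₀, hi₁, hj₁, hω₁, hi₂, hj₂, hω₂, hi₃, hj₃, hω₃,
      -zsmul_eq_mul]
    simp only [zsmul_eq_mul]
    linarith

open scoped IsMulCommutative in
/-- The reduced trace and the reduced norm of an integral quaternion are integral. -/
theorem IsIntegral.quaternion_trace_and_normSq {R : Type*} [CommRing R] [Algebra R ℚ]
    {x : ℍ[ℚ]} (hx : IsIntegral R x) :
    IsIntegral R (2 * x.re) ∧ IsIntegral R (normSq x) := by
  have hs : IsIntegral R (star x) := by
    obtain ⟨p, hp, h0⟩ := hx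
    refine ⟨p, hp, ?_⟩
    have := congrArg star h0
    rw [← Polynomial.aeval_def] at this ⊢
    simpa [Polynomial.aeval_eq_sum_range] using this
  let S := Algebra.adjoin R {x, star x}
  have hcomm : IsMulCommutative S := Algebra.isMulCommutative_adjoin R (by
    have := (star_comm_self' x)
    simp [this])
  let u : S := ⟨x, Algebra.subset_adjoin (by simp)⟩
  let v : S := ⟨star x, Algebra.subset_adjoin (by simp)⟩
  have hval : Function.Injective S.val := Subtype.val_injective
  have hu : IsIntegral R u := (isIntegral_algHom_iff S.val hval).1 hx
  have hv : IsIntegral R v := (isIntegral_algHom_iff S.val hval).1 hs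
  have hadd : IsIntegral R (x + star x) := (hu.add hv).map S.val
  have hmul : IsIntegral R (x * star x) := (hu.mul hv).map S.val
  have hinj : Function.Injective (algebraMap ℚ ℍ[ℚ]) := (algebraMap ℚ ℍ[ℚ]).injective
  rw [self_add_star'] at hadd
  rw [self_mul_star] at hmul
  exact ⟨(isIntegral_algebraMap_iff hinj).1 hadd, (isIntegral_algebraMap_iff hinj).1 hmul⟩

theorem exists_int_mul_pow_of_mem_ZInvLoc {ℓ : ℕ} (hℓ : ℓ ≠ 0) {r : ℚ} (hr : r ∈ ZInvLoc ℓ) :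
    ∃ (m : ℕ) (z : ℤ), r * (ℓ : ℚ) ^ m = z := by
  induction hr using Subring.closure_induction with
  | mem x hx =>
    rw [Set.mem_singleton_iff] at hx
    exact ⟨1, 1, by subst hx; field_simp; simp⟩
  | zero => exact ⟨0, 0, by simp⟩
  | one => exact ⟨0, 1, by simp⟩
  | add x y _ _ hx hy =>
    obtain ⟨m, z, h⟩ := hx
    obtain ⟨m', z', h'⟩ := hy
    refine ⟨m + m', z * ℓ ^ m' + z' * ℓ ^ m, ?_⟩
    push_cast
    rw [← h, ← h']; ring
  | neg x _ hx =>
    obtain ⟨m, z, h⟩ := hx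
    exact ⟨m, -z, by push_cast; rw [← h]; ring⟩
  | mul x y _ _ hx hy =>
    obtain ⟨m, z, h⟩ := hx
    obtain ⟨m', z', h'⟩ := hy
    refine ⟨m + m', z * z', ?_⟩
    push_cast
    rw [← h, ← h']; ring

theorem inv_natCast_mem_ZInvLoc (ℓ : ℕ) : (ℓ : ℚ)⁻¹ ∈ ZInvLoc ℓ :=
  Subring.subset_closure rfl

theorem isLocalization_ZInvLoc {ℓ : ℕ} (hℓ : ℓ ≠ 0) :
    IsLocalization (Submonoid.powers (ℓ : ℤ)) (ZInvLoc ℓ) where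
  map_units := by
    rintro ⟨_, m, rfl⟩
    refine IsUnit.of_mul_eq_one ⟨((ℓ : ℚ)⁻¹) ^ m, pow_mem (inv_natCast_mem_ZInvLoc ℓ) m⟩ ?_
    apply Subtype.ext
    have : (ℓ : ℚ) ≠ 0 := by exact_mod_cast hℓ
    simp [this]
  surj := by
    rintro ⟨r, hr⟩
    obtain ⟨m, z, h⟩ := exists_int_mul_pow_of_mem_ZInvLoc hℓ hr
    refine ⟨(z, ⟨_, m, rfl⟩), Subtype.ext ?_⟩
    simpa using h
  exists_of_eq := by
    intro x y h
    exact ⟨1, by simpa using h⟩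

/-- A rational number that is integral over `ℤ[1/ℓ]` becomes an integer after multiplication by a
power of `ℓ`. -/
theorem exists_int_pow_mul_of_isIntegral {ℓ : ℕ} (hℓ : ℓ ≠ 0) {r : ℚ}
    (hr : IsIntegral (ZInvLoc ℓ) r) : ∃ (m : ℕ) (z : ℤ), (ℓ : ℚ) ^ m * r = z := by
  have := isLocalization_ZInvLoc hℓ
  obtain ⟨⟨_, m, rfl⟩, h⟩ :=
    hr.exists_multiple_integral_of_isLocalization (Submonoid.powers (ℓ : ℤ)) r
  obtain ⟨z, hz⟩ := IsIntegrallyClosed.isIntegral_iff.1 h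
  refine ⟨m, z, ?_⟩
  simpa [Submonoid.smul_def] using hz.symm

/-- Every element of a maximal `ℤ[1/ℓ]`-order of `ℍ[ℚ]` (for `ℓ` odd) has the same minimal
polynomial — i.e. the same reduced trace and reduced norm — as some element of `O[1/ℓ]`,
where `O` is the Hurwitz order. -/
theorem exists_elt_of_hurwitz_loc_with_same_min_poly (ℓ : ℕ) (hℓ : 2 ≤ ℓ) (hodd : Odd ℓ)
    (O' : Subring ℍ[ℚ])
    (hZ : ∀ r : ℚ, r ∈ ZInvLoc ℓ → algebraMap ℚ ℍ[ℚ] r ∈ O')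
    (hfg : ∃ s : Finset ℍ[ℚ],
      (Submodule.span ↥(ZInvLoc ℓ) (s : Set ℍ[ℚ]) : Set ℍ[ℚ]) = (O' : Set ℍ[ℚ]))
    (hspan : Submodule.span ℚ (O' : Set ℍ[ℚ]) = ⊤)
    (hmax : ∀ T : Subring ℍ[ℚ],
      ((∀ r : ℚ, r ∈ ZInvLoc ℓ → algebraMap ℚ ℍ[ℚ] r ∈ T) ∧
        (∃ t : Finset ℍ[ℚ],
          (Submodule.span ↥(ZInvLoc ℓ) (t : Set ℍ[ℚ]) : Set ℍ[ℚ]) = (T : Set ℍ[ℚ])) ∧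
        Submodule.span ℚ (T : Set ℍ[ℚ]) = ⊤) →
      O' ≤ T → T = O') :
    ∀ x' ∈ O', ∃ x ∈ HurwitzOrderInvLoc ℓ,
      x.re = x'.re ∧ normSq x = normSq x' := by
  intro x hx
  have h0 : ℓ ≠ 0 := by omega
  have hℓ0 : (ℓ : ℚ) ≠ 0 := by exact_mod_cast h0
  have hint : IsIntegral (ZInvLoc ℓ) x := by
    let S : Subalgebra (ZInvLoc ℓ) ℍ[ℚ] :=
      { O' with algebraMap_mem' := fun r => hZ r r.2 }
    obtain ⟨s, hs⟩ := hfg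
    exact IsIntegral.of_mem_of_fg S ⟨s, SetLike.coe_injective hs⟩ x hx
  obtain ⟨ht, hn⟩ := hint.quaternion_trace_and_normSq
  obtain ⟨j, t, ht⟩ := exists_int_pow_mul_of_isIntegral h0 ht
  obtain ⟨k, n, hn⟩ := exists_int_pow_mul_of_isIntegral h0 hn
  set L : ℚ := (ℓ : ℚ) ^ (j + k) with hL
  have hL0 : L ≠ 0 := pow_ne_zero _ hℓ0
  have hLt : L * (2 * x.re) = (ℓ ^ k * t : ℤ) := by push_cast; rw [← ht, hL]; ring
  have hLn : L ^ 2 * normSq x = (ℓ ^ (2 * j + k) * n : ℤ) := by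
    push_cast; rw [← hn, hL]; ring
  obtain ⟨q, hq, hre, hnorm⟩ := exists_mem_hurwitzOrder (t := ℓ ^ k * t)
    (n := ℓ ^ (2 * j + k) * n) (x := 2 * L * x.imI) (y := 2 * L * x.imJ) (z := 2 * L * x.imK) (by
      rw [← hLt, ← hLn, normSq_def']; ring)
  rw [← hLt] at hre
  rw [← hLn] at hnorm
  refine ⟨L⁻¹ • q, ?_, ?_, ?_⟩
  · have hinv : ((ℓ : ℚ)⁻¹ • (1 : ℍ[ℚ])) ∈ HurwitzOrderInvLoc ℓ :=
      Subring.subset_closure (Or.inr rfl)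
    have hmem := mul_mem (pow_mem hinv (j + k))
      (Subring.subset_closure (Or.inl hq) : q ∈ HurwitzOrderInvLoc ℓ)
    rwa [smul_pow, one_pow, smul_mul_assoc, one_mul, inv_pow, ← hL] at hmem
  · rw [re_smul, smul_eq_mul]
    field_simp
    linarith
  · rw [normSq_smul, hnorm]
    field_simp
end

section
/- Let W = W(F₄) be the ring of 2-typical Witt vectors over the field F₄ with four elements, and φ : W → W the Witt-vector Frobenius ring homomorphism. For a ∈ W write Tr(a) = a + φ(a) and N(a) = a·φ(a). Suppose a, b ∈ W satisfy 2 + Tr(a) = 0 and Tr(a) + N(a) - 2·N(b) = 0. Then a ∈ 2W and b is a unit of W. -/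
local notation "W" => WittVector 2 (GaloisField 2 2)

/-- Over a perfect ring of characteristic `p`, a Witt vector whose zeroth coefficient vanishes is
divisible by `p`. -/
theorem WittVector.exists_eq_p_mul_of_coeff_zero_eq_zero {p : ℕ} [Fact p.Prime] {R : Type*}
    [CommRing R] [CharP R p] [PerfectRing R p] (x : WittVector p R) (hx : x.coeff 0 = 0) :
    ∃ y : WittVector p R, x = p * y := by
  obtain ⟨y, hy⟩ := (WittVector.frobenius_bijective p R).surjective (x.shift 1)
  refine ⟨y, ?_⟩
  have h := WittVector.verschiebung_shift x 0 (fun i hi => by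
    obtain rfl : i = 0 := by omega
    exact hx)
  rw [mul_comm, ← WittVector.verschiebung_frobenius, hy, h]
  ext n
  rw [WittVector.shift_coeff, zero_add]

/-- In `W = W(𝔽₄)`, if `a, b` satisfy `2 + Tr(a) = 0` and `Tr(a) + N(a) - 2N(b) = 0`
(i.e. `x = (1+a) + bS` has minimal polynomial `x² + 1`), then `a ≡ 0 (mod 2)` and
`b` is a unit. -/
theorem witt_trace_norm_claim_one (a b : W)
    (htr : 2 + (a + WittVector.frobenius a) = 0)
    (hnorm : (a + WittVector.frobenius a) + a * WittVector.frobenius a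
      - 2 * (b * WittVector.frobenius b) = 0) :
    (∃ a' : W, a = 2 * a') ∧ IsUnit b := by
  have h_two : (2 : W) ≠ 0 := mod_cast WittVector.p_nonzero 2 (GaloisField 2 2)
  have h_const : WittVector.constantCoeff (2 : W) = 0 :=
    mod_cast WittVector.coeff_p_zero 2 (GaloisField 2 2)
  have h_frob (x : W) : WittVector.constantCoeff (WittVector.frobenius x) =
      WittVector.constantCoeff x ^ 2 := WittVector.coeff_frobenius_charP 2 x 0
  have h_norm_a : a * WittVector.frobenius a = 2 * (1 + b * WittVector.frobenius b) := by
    linear_combination hnorm - htr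
  have ha : a.coeff 0 = 0 := by
    have h := congrArg WittVector.constantCoeff h_norm_a
    rw [map_mul, map_mul, h_frob, h_const, zero_mul, ← pow_succ'] at h
    exact eq_zero_of_pow_eq_zero h
  obtain ⟨a', ha'⟩ := WittVector.exists_eq_p_mul_of_coeff_zero_eq_zero a ha
  rw [Nat.cast_ofNat] at ha'
  refine ⟨⟨a', ha'⟩, WittVector.isUnit_of_coeff_zero_ne_zero b fun hb => ?_⟩
  have h_norm_b : 2 * (a' * WittVector.frobenius a') = 1 + b * WittVector.frobenius b := by
    refine mul_left_cancel₀ h_two ?_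
    rw [← h_norm_a, ha', map_mul, map_ofNat]
    ring
  have h := congrArg WittVector.constantCoeff h_norm_b
  have hb' : WittVector.constantCoeff b = 0 := hb
  rw [map_mul, map_add, map_mul _ b, map_one, h_const, hb', zero_mul, zero_mul, add_zero] at h
  exact zero_ne_one h
end

section
/- Let W = W(F₄) be the ring of 2-typical Witt vectors over the field F₄ with four elements, and φ : W → W the Witt-vector Frobenius ring homomorphism; write Tr(a) = a + φ(a) and N(a) = a·φ(a). Let α ∈ W satisfy φ(α) = α and α - 6 ∈ 16W. Suppose a, b ∈ W satisfy 2 + Tr(a) = -α and Tr(a) + N(a) - 2·N(b) = 0. Then a ∈ 2W, b ∈ 2W, and b ∉ 4W. -/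
local notation "W" => WittVector 2 (GaloisField 2 2)

namespace WittVector

variable {p : ℕ} [Fact p.Prime] {k : Type*} [Field k] [CharP k p] [PerfectRing k p]

theorem p_dvd_of_p_dvd_frobenius {x : WittVector p k}
    (h : (p : WittVector p k) ∣ frobenius x) : (p : WittVector p k) ∣ x := by
  obtain ⟨y, hy⟩ := h
  obtain ⟨z, rfl⟩ := (frobenius_bijective p k).surjective y
  exact ⟨z, (frobenius_bijective p k).injective (by rw [hy, map_mul, map_natCast])⟩

theorem p_dvd_of_p_dvd_mul_frobenius {x : WittVector p k}
    (h : (p : WittVector p k) ∣ x * frobenius x) : (p : WittVector p k) ∣ x :=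
  ((irreducible p).prime.dvd_or_dvd h).elim id p_dvd_of_p_dvd_frobenius

end WittVector

/-- In `W = W(𝔽₄)`, let `α ∈ ℤ₂ ⊆ W` (i.e. `φ(α) = α`) with `α ≡ 6 (mod 16)`.
If `a, b ∈ W` satisfy `2 + Tr(a) = -α` and `Tr(a) + N(a) - 2N(b) = 0`
(i.e. `x = (1+a) + bS` has minimal polynomial `x² + αx + 1`), then
`a ≡ 0 (mod 2)` and `b` has `2`-adic valuation exactly `1`. -/
theorem witt_trace_norm_claim_two (α a b : W)
    (hα : WittVector.frobenius α = α)
    (hα6 : ∃ c : W, α - 6 = 16 * c)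
    (htr : 2 + (a + WittVector.frobenius a) = -α)
    (hnorm : (a + WittVector.frobenius a) + a * WittVector.frobenius a
      - 2 * (b * WittVector.frobenius b) = 0) :
    (∃ a' : W, a = 2 * a') ∧ (∃ b' : W, b = 2 * b') ∧ ¬ (∃ b'' : W, b = 4 * b'') := by
  have two_dvd {x : W} (h : 2 ∣ x * WittVector.frobenius x) : 2 ∣ x := by
    simpa using WittVector.p_dvd_of_p_dvd_mul_frobenius (p := 2) (x := x) (by simpa using h)
  have h2 : (2 : W) ≠ 0 := by
    simpa using WittVector.p_nonzero 2 (GaloisField 2 2)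
  have not_two_dvd_one : ¬ (2 : W) ∣ 1 := by
    simpa [isUnit_iff_dvd_one] using
      (WittVector.irreducible (p := 2) (k := GaloisField 2 2)).not_isUnit
  obtain ⟨c, hc⟩ := hα6
  have htr' : a + WittVector.frobenius a = -8 * (1 + 2 * c) := by
    linear_combination htr - hc
  rw [htr'] at hnorm
  obtain ⟨a, rfl⟩ : (2 : W) ∣ a := two_dvd
    ⟨b * WittVector.frobenius b + 4 * (1 + 2 * c), by linear_combination hnorm⟩
  simp only [map_mul, map_ofNat] at hnorm
  have hb : b * WittVector.frobenius b =
      2 * (a * WittVector.frobenius a - 2 * (1 + 2 * c)) :=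
    mul_left_cancel₀ h2 (by linear_combination -hnorm)
  obtain ⟨b, rfl⟩ : (2 : W) ∣ b := two_dvd ⟨_, hb⟩
  simp only [map_mul, map_ofNat] at hb
  have ha : a * WittVector.frobenius a =
      2 * (b * WittVector.frobenius b + (1 + 2 * c)) :=
    mul_left_cancel₀ h2 (by linear_combination -hb)
  obtain ⟨a, rfl⟩ : (2 : W) ∣ a := two_dvd ⟨_, ha⟩
  simp only [map_mul, map_ofNat] at ha
  refine ⟨⟨_, rfl⟩, ⟨_, rfl⟩, ?_⟩
  rintro ⟨d, hd⟩
  obtain rfl : b = 2 * d := mul_left_cancel₀ h2 (by linear_combination hd)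
  simp only [map_mul, map_ofNat] at ha
  have h1 : 2 * (a * WittVector.frobenius a) =
      4 * (d * WittVector.frobenius d) + (1 + 2 * c) :=
    mul_left_cancel₀ h2 (by linear_combination ha)
  exact not_two_dvd_one
    ⟨a * WittVector.frobenius a - 2 * (d * WittVector.frobenius d) - c, by
      linear_combination -h1⟩
end

section
/- Let p be an odd prime, ℓ ≥ 2 an integer coprime to p, r an integer with p ∤ r, and m ≥ 1 an integer such that (pr+2)² < 4·ℓ^(2mp(p-1)). Set α = -(pr+2)/ℓ^(mp(p-1)) ∈ ℚ. Then the polynomial f(x) = x² + αx + 1 is irreducible over ℝ and irreducible over the p-adic field ℚ_p. -/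
open Polynomial

/-- A root of `x² - (a/L)x + 1` makes the scaled discriminant `a² - 4L²` a square, so the
polynomial is irreducible when the latter is not a square. -/
theorem irreducible_map_quadratic_of_not_isSquare {K : Type*} [Field K] [Algebra ℚ K]
    (a L : ℚ) (hL : L ≠ 0) (h : ¬ IsSquare (algebraMap ℚ K (a ^ 2 - 4 * L ^ 2))) :
    Irreducible ((X ^ 2 + C (-a / L) * X + 1 : ℚ[X]).map (algebraMap ℚ K)) := by
  have hmonic : (X ^ 2 + C (-a / L) * X + 1 : ℚ[X]).Monic := by monicity!
  have hdeg : (X ^ 2 + C (-a / L) * X + 1 : ℚ[X]).natDegree = 2 := by compute_degree!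
  have hdeg' := hmonic.natDegree_map (algebraMap ℚ K)
  rw [hdeg] at hdeg'
  rw [(hmonic.map _).irreducible_iff_roots_eq_zero_of_degree_le_three hdeg'.ge (by lia),
    Multiset.eq_zero_iff_forall_notMem]
  intro x hx
  apply h
  have hroot := (mem_roots'.mp hx).2
  have hL' : algebraMap ℚ K L ≠ 0 := (_root_.map_ne_zero _).mpr hL
  simp only [IsRoot.def, Polynomial.map_add, Polynomial.map_mul, Polynomial.map_pow, map_X, map_C,
    Polynomial.map_one, eval_add, eval_mul, eval_pow, eval_X, eval_C, eval_one, map_div₀,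
    map_neg] at hroot
  field_simp at hroot
  refine ⟨2 * algebraMap ℚ K L * x - algebraMap ℚ K a, ?_⟩
  simp only [map_sub, map_mul, map_pow, map_ofNat]
  linear_combination (-4 * algebraMap ℚ K L) * hroot

theorem Padic.not_isSquare_intCast_of_dvd_of_not_sq_dvd {p : ℕ} [Fact p.Prime] {D : ℤ}
    (h₁ : (p : ℤ) ∣ D) (h₂ : ¬ (p : ℤ) ^ 2 ∣ D) : ¬ IsSquare (D : ℚ_[p]) := by
  rintro ⟨y, hy⟩
  have hD : D ≠ 0 := by rintro rfl; exact h₂ (dvd_zero _)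
  have hval : padicValInt p D = 1 := by
    have h1 := (padicValInt_dvd_iff 1 D).mp (by simpa using h₁)
    have h2 := mt (padicValInt_dvd_iff 2 D).mpr h₂
    lia
  have h := congrArg Padic.valuation hy
  rw [← pow_two, Padic.valuation_pow, Padic.valuation_intCast, hval] at h
  lia

theorem sq_dvd_pow_mul_sub_one {p ℓ : ℕ} (hp : p.Prime) (hcop : Nat.Coprime ℓ p) (m : ℕ) :
    (p : ℤ) ^ 2 ∣ (ℓ : ℤ) ^ (m * p * (p - 1)) - 1 := by
  have h := Nat.ModEq.pow_totient ((hcop.pow_left m).pow_right 2)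
  rw [Nat.totient_prime_pow hp two_pos, ← pow_mul] at h
  have h' := (Nat.modEq_iff_dvd.mp h.symm)
  push_cast at h'
  simpa [mul_assoc] using h'

/-- For `p` an odd prime, `ℓ ≥ 2` coprime to `p`, `r` an integer prime to `p`, and
`m ≥ 1` with `(pr+2)² < 4ℓ^(2mp(p-1))`, the polynomial
`x² - ((pr+2)/ℓ^(mp(p-1)))x + 1` is irreducible over `ℝ` and over `ℚ_p`. -/
theorem quadratic_irreducible_over_R_and_Qp (p : ℕ) [Fact p.Prime] (hodd : Odd p)
    (ℓ : ℕ) (hℓ : 2 ≤ ℓ) (hcop : Nat.Coprime ℓ p)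
    (r : ℤ) (hr : ¬ (p : ℤ) ∣ r)
    (m : ℕ) (hm : 1 ≤ m)
    (hbound : ((p : ℤ) * r + 2) ^ 2 < 4 * (ℓ : ℤ) ^ (2 * m * p * (p - 1))) :
    Irreducible
      ((X ^ 2 + C (-(((p : ℚ) * r + 2)) / (ℓ : ℚ) ^ (m * p * (p - 1))) * X + 1 : ℚ[X]).map
        (algebraMap ℚ ℝ)) ∧
    Irreducible
      ((X ^ 2 + C (-(((p : ℚ) * r + 2)) / (ℓ : ℚ) ^ (m * p * (p - 1))) * X + 1 : ℚ[X]).map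
        (algebraMap ℚ ℚ_[p])) := by
  have hp : p.Prime := Fact.out
  have hL : (ℓ : ℚ) ^ (m * p * (p - 1)) ≠ 0 := pow_ne_zero _ (by positivity)
  have hbound' : ((p : ℤ) * r + 2) ^ 2 - 4 * ((ℓ : ℤ) ^ (m * p * (p - 1))) ^ 2 < 0 := by
    rw [← pow_mul, show m * p * (p - 1) * 2 = 2 * m * p * (p - 1) by ring]
    linarith
  have hcast : ((p : ℚ) * r + 2) ^ 2 - 4 * ((ℓ : ℚ) ^ (m * p * (p - 1))) ^ 2 =
      ((((p : ℤ) * r + 2) ^ 2 - 4 * ((ℓ : ℤ) ^ (m * p * (p - 1))) ^ 2 : ℤ) : ℚ) := by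
    push_cast
    rfl
  constructor
  · apply irreducible_map_quadratic_of_not_isSquare _ _ hL
    rw [hcast, map_intCast]
    intro hsq
    exact absurd hsq.nonneg (not_le.mpr (Int.cast_lt_zero.mpr hbound'))
  · apply irreducible_map_quadratic_of_not_isSquare _ _ hL
    rw [hcast, map_intCast]
    obtain ⟨k, hk⟩ := sq_dvd_pow_mul_sub_one hp hcop m
    rw [sub_eq_iff_eq_add.mp hk]
    have hpz : Prime (p : ℤ) := Nat.prime_iff_prime_int.mp hp
    apply Padic.not_isSquare_intCast_of_dvd_of_not_sq_dvd
    · exact ⟨p * r ^ 2 + 4 * r - 4 * (p ^ 3 * k ^ 2 + 2 * p * k), by ring⟩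
    · rintro ⟨c, hc⟩
      have h4r : (p : ℤ) ∣ 2 ^ 2 * r :=
        ⟨c - r ^ 2 + 4 * (p ^ 2 * k ^ 2 + 2 * k),
          mul_left_cancel₀ hpz.ne_zero (by linear_combination hc)⟩
      refine (hpz.dvd_or_dvd h4r).elim (fun h => ?_) hr
      have h2 : p ∣ 2 := by exact_mod_cast hpz.dvd_of_dvd_pow h
      rw [(Nat.prime_dvd_prime_iff_eq hp Nat.prime_two).mp h2] at hodd
      exact absurd hodd (by decide)
end

section
/- Let p be a prime, ℓ ≥ 2 an integer coprime to p, and a an integer such that the polynomial x² + āx + 1 is irreducible over the field F_p with p elements, where ā is the reduction of a modulo p. Let m ≥ 1 be an integer with a² < 4·ℓ^(2m(p-1)). Then the polynomial x² + (a/ℓ^(m(p-1)))x + 1 with rational coefficients is irreducible over ℚ_p and irreducible over ℝ. -/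
open Polynomial

theorem monic_quadratic {R : Type*} [CommRing R] (b : R) :
    (X ^ 2 + C b * X + 1 : R[X]).Monic := by
  nontriviality R
  monicity!

/-- A quadratic `x² + bx + 1` over `ℤ_[p]` that is irreducible modulo `p` is irreducible
over `ℚ_[p]`. -/
theorem irreducible_quadratic_padic {p : ℕ} [Fact p.Prime] (b : ℤ_[p])
    (h : Irreducible (X ^ 2 + C (PadicInt.toZMod b) * X + 1 : (ZMod p)[X])) :
    Irreducible (X ^ 2 + C (b : ℚ_[p]) * X + 1 : ℚ_[p][X]) := by
  have hZ : Irreducible (X ^ 2 + C b * X + 1 : ℤ_[p][X]) :=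
    (monic_quadratic b).irreducible_of_irreducible_map PadicInt.toZMod _ (by simpa using h)
  have := ((monic_quadratic b).irreducible_iff_irreducible_map_fraction_map
    (K := ℚ_[p])).1 hZ
  simpa using this

theorem irreducible_quadratic_real {b : ℝ} (hb : b ^ 2 < 4) :
    Irreducible (X ^ 2 + C b * X + 1 : ℝ[X]) := by
  have hdeg : (X ^ 2 + C b * X + 1 : ℝ[X]).natDegree = 2 := by compute_degree!
  refine irreducible_of_degree_le_three_of_not_isRoot (by simp [hdeg]) fun x hx => ?_
  simp only [IsRoot.def, eval_add, eval_mul, eval_pow, eval_X, eval_C, eval_one] at hx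
  nlinarith [sq_nonneg (2 * x + b)]

/-- Let `p` be prime, `ℓ ≥ 2` coprime to `p`, and `a` an integer such that `x² + āx + 1`
is irreducible over `𝔽_p`.  If `m ≥ 1` satisfies `a² < 4ℓ^(2m(p-1))`, then
`x² + (a/ℓ^(m(p-1)))x + 1` is irreducible over `ℚ_p` and over `ℝ`. -/
theorem quadratic_lift_irreducible_over_Qp_and_R (p : ℕ) [Fact p.Prime]
    (ℓ : ℕ) (hℓ : 2 ≤ ℓ) (hcop : Nat.Coprime ℓ p)
    (a : ℤ)
    (hirr : Irreducible (X ^ 2 + C (a : ZMod p) * X + 1 : (ZMod p)[X]))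
    (m : ℕ) (hm : 1 ≤ m)
    (hbound : a ^ 2 < 4 * (ℓ : ℤ) ^ (2 * m * (p - 1))) :
    Irreducible
      ((X ^ 2 + C ((a : ℚ) / (ℓ : ℚ) ^ (m * (p - 1))) * X + 1 : ℚ[X]).map
        (algebraMap ℚ ℚ_[p])) ∧
    Irreducible
      ((X ^ 2 + C ((a : ℚ) / (ℓ : ℚ) ^ (m * (p - 1))) * X + 1 : ℚ[X]).map
        (algebraMap ℚ ℝ)) := by
  constructor
  · have hu : IsUnit ((ℓ : ℤ_[p]) ^ (m * (p - 1))) :=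
      (PadicInt.isUnit_iff.2 (PadicInt.norm_natCast_eq_one_iff.2 hcop.symm)).pow _
    obtain ⟨v, hv⟩ := hu.exists_right_inv
    have hℓ0 : (ℓ : ZMod p) ≠ 0 := ((ZMod.isUnit_iff_coprime ℓ p).2 hcop).ne_zero
    have hred : PadicInt.toZMod v = 1 := by
      have := congrArg PadicInt.toZMod hv
      simpa [mul_comm m, pow_mul, ZMod.pow_card_sub_one_eq_one hℓ0] using this
    have hinv : (v : ℚ_[p]) = ((ℓ : ℚ_[p]) ^ (m * (p - 1)))⁻¹ := by
      refine eq_inv_of_mul_eq_one_right ?_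
      exact_mod_cast congrArg ((↑) : ℤ_[p] → ℚ_[p]) hv
    have := irreducible_quadratic_padic ((a : ℤ_[p]) * v) (by simpa [hred] using hirr)
    simpa [hinv, div_eq_mul_inv] using this
  · have hb : ((a : ℝ) / (ℓ : ℝ) ^ (m * (p - 1))) ^ 2 < 4 := by
      rw [div_pow, div_lt_iff₀ (by positivity), ← pow_mul, mul_comm _ 2, ← mul_assoc]
      exact_mod_cast hbound
    simpa using irreducible_quadratic_real hb
end

section
/- The group of units of the Hurwitz order O (the binary tetrahedral group) has exactly 24 elements. -/
open Quaternion

namespace HurwitzOrder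

/-- The integral combination `a ω + m i + n j + p k`. -/
def ofCoords (v : ℤ × ℤ × ℤ × ℤ) : ℍ[ℚ] :=
  ⟨v.1 / 2, v.1 / 2 + v.2.1, v.1 / 2 + v.2.2.1, v.1 / 2 + v.2.2.2⟩

@[simp]
theorem re_ofCoords (v : ℤ × ℤ × ℤ × ℤ) : (ofCoords v).re = v.1 / 2 := rfl

@[simp]
theorem imI_ofCoords (v : ℤ × ℤ × ℤ × ℤ) : (ofCoords v).imI = v.1 / 2 + v.2.1 := rfl

@[simp]
theorem imJ_ofCoords (v : ℤ × ℤ × ℤ × ℤ) : (ofCoords v).imJ = v.1 / 2 + v.2.2.1 := rfl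

@[simp]
theorem imK_ofCoords (v : ℤ × ℤ × ℤ × ℤ) : (ofCoords v).imK = v.1 / 2 + v.2.2.2 := rfl

/-- The reduced norm of `a ω + m i + n j + p k`. -/
def normForm (v : ℤ × ℤ × ℤ × ℤ) : ℤ :=
  v.1 ^ 2 + v.1 * (v.2.1 + v.2.2.1 + v.2.2.2) + v.2.1 ^ 2 + v.2.2.1 ^ 2 + v.2.2.2 ^ 2

theorem ofCoords_injective : Function.Injective ofCoords := by
  rintro ⟨a, m, n, p⟩ ⟨a', m', n', p'⟩ h
  have h₀ := congrArg (·.re) h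
  have h₁ := congrArg (·.imI) h
  have h₂ := congrArg (·.imJ) h
  have h₃ := congrArg (·.imK) h
  simp only [re_ofCoords, imI_ofCoords, imJ_ofCoords, imK_ofCoords] at h₀ h₁ h₂ h₃
  have ha : (a : ℚ) = a' := by linarith
  have hm : (m : ℚ) = m' := by linarith
  have hn : (n : ℚ) = n' := by linarith
  have hp : (p : ℚ) = p' := by linarith
  norm_cast at ha hm hn hp
  simp [ha, hm, hn, hp]

theorem normSq_ofCoords (v : ℤ × ℤ × ℤ × ℤ) : normSq (ofCoords v) = (normForm v : ℚ) := by
  simp only [normSq_def', re_ofCoords, imI_ofCoords, imJ_ofCoords, imK_ofCoords, normForm]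
  push_cast
  ring

theorem ofCoords_mul (a m n p a' m' n' p' : ℤ) :
    ofCoords (a, m, n, p) * ofCoords (a', m', n', p') = ofCoords
      (-(a * a') - (a * m' + m * a' + a * n' + n * a' + a * p' + p * a')
          - 2 * (m * m' + n * n' + p * p'),
        a * a' + a * m' + m * a' + a * p' + n * a' + n * p' - p * n'
          + (m * m' + n * n' + p * p'),
        a * a' + a * n' + n * a' + a * m' + p * a' + p * m' - m * p'
          + (m * m' + n * n' + p * p'),
        a * a' + a * p' + p * a' + a * n' + m * a' + m * n' - n * m'
          + (m * m' + n * n' + p * p')) := by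
  ext <;> simp <;> ring

theorem ofCoords_i : ofCoords (0, 1, 0, 0) = ⟨0, 1, 0, 0⟩ := by
  ext <;> simp

theorem ofCoords_j : ofCoords (0, 0, 1, 0) = ⟨0, 0, 1, 0⟩ := by
  ext <;> simp

theorem ofCoords_ω : ofCoords (1, 0, 0, 0) = ⟨1/2, 1/2, 1/2, 1/2⟩ := by
  ext <;> simp

theorem ofCoords_mem (v : ℤ × ℤ × ℤ × ℤ) : ofCoords v ∈ HurwitzOrder := by
  obtain ⟨a, m, n, p⟩ := v
  have hi : ofCoords (0, 1, 0, 0) ∈ HurwitzOrder := ofCoords_i ▸ Subring.subset_closure (.inl rfl)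
  have hj : ofCoords (0, 0, 1, 0) ∈ HurwitzOrder :=
    ofCoords_j ▸ Subring.subset_closure (.inr (.inl rfl))
  have hω : ofCoords (1, 0, 0, 0) ∈ HurwitzOrder :=
    ofCoords_ω ▸ Subring.subset_closure (.inr (.inr rfl))
  convert add_mem (add_mem (add_mem (zsmul_mem hω a) (zsmul_mem hi m)) (zsmul_mem hj n))
    (zsmul_mem (mul_mem hi hj) p) using 1
  ext <;> simp <;> ring

theorem mem_iff_exists_ofCoords {x : ℍ[ℚ]} : x ∈ HurwitzOrder ↔ ∃ v, ofCoords v = x := by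
  refine ⟨fun hx ↦ ?_, by rintro ⟨v, rfl⟩; exact ofCoords_mem v⟩
  induction hx using Subring.closure_induction with
  | mem x hx =>
    rcases hx with rfl | rfl | rfl
    · exact ⟨_, ofCoords_i⟩
    · exact ⟨_, ofCoords_j⟩
    · exact ⟨_, ofCoords_ω⟩
  | zero => exact ⟨0, by ext <;> simp⟩
  | one => exact ⟨(2, -1, -1, -1), by ext <;> simp⟩
  | add x y _ _ hx hy =>
    obtain ⟨v, rfl⟩ := hx
    obtain ⟨w, rfl⟩ := hy
    exact ⟨v + w, by ext <;> simp <;> ring⟩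
  | neg x _ hx =>
    obtain ⟨v, rfl⟩ := hx
    exact ⟨-v, by ext <;> simp <;> ring⟩
  | mul x y _ _ hx hy =>
    obtain ⟨⟨a, m, n, p⟩, rfl⟩ := hx
    obtain ⟨⟨a', m', n', p'⟩, rfl⟩ := hy
    exact ⟨_, (ofCoords_mul a m n p a' m' n' p').symm⟩

theorem normForm_nonneg (v : ℤ × ℤ × ℤ × ℤ) : 0 ≤ normForm v := by
  have h : (0 : ℚ) ≤ normForm v := normSq_ofCoords v ▸ normSq_nonneg
  exact_mod_cast h

theorem star_ofCoords (a m n p : ℤ) :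
    star (ofCoords (a, m, n, p)) = ofCoords (a, -a - m, -a - n, -a - p) := by
  ext <;> simp <;> ring

theorem star_mem {x : ℍ[ℚ]} (hx : x ∈ HurwitzOrder) : star x ∈ HurwitzOrder := by
  obtain ⟨⟨a, m, n, p⟩, rfl⟩ := mem_iff_exists_ofCoords.1 hx
  exact star_ofCoords a m n p ▸ ofCoords_mem _

theorem normForm_eq_one_of_mul_eq_one {v w : ℤ × ℤ × ℤ × ℤ}
    (h : ofCoords v * ofCoords w = 1) : normForm v = 1 := by
  have h' := congrArg normSq h
  rw [map_mul, map_one, normSq_ofCoords, normSq_ofCoords] at h'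
  norm_cast at h'
  exact Int.eq_one_of_mul_eq_one_right (normForm_nonneg v) h'

theorem range_units_val :
    Set.range (fun u : (↥HurwitzOrder)ˣ ↦ ((u : HurwitzOrder) : ℍ[ℚ])) =
      ofCoords '' {v | normForm v = 1} := by
  ext x
  constructor
  · rintro ⟨u, rfl⟩
    obtain ⟨v, hv⟩ := mem_iff_exists_ofCoords.1 (u : HurwitzOrder).2
    obtain ⟨w, hw⟩ := mem_iff_exists_ofCoords.1 (↑u⁻¹ : HurwitzOrder).2
    refine ⟨v, normForm_eq_one_of_mul_eq_one (w := w) ?_, hv⟩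
    rw [hv, hw]
    exact congrArg Subtype.val u.mul_inv
  · rintro ⟨v, hv, rfl⟩
    have hn : normSq (ofCoords v) = 1 := by
      rw [normSq_ofCoords, show normForm v = 1 from hv, Int.cast_one]
    refine ⟨⟨⟨ofCoords v, ofCoords_mem v⟩, ⟨star (ofCoords v), star_mem (ofCoords_mem v)⟩,
      Subtype.ext ?_, Subtype.ext ?_⟩, rfl⟩
    · simp [self_mul_star, hn]
    · simp [star_mul_self, hn]

/-- The coordinates of the elements of norm one, found in a finite box. -/
noncomputable def normOneCoords : Finset (ℤ × ℤ × ℤ × ℤ) :=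
  {v ∈ Finset.Icc (-2) 2 ×ˢ Finset.Icc (-2) 2 ×ˢ Finset.Icc (-2) 2 ×ˢ Finset.Icc (-2) 2 |
    v.1 ^ 2 + v.1 * (v.2.1 + v.2.2.1 + v.2.2.2) + v.2.1 ^ 2 + v.2.2.1 ^ 2 + v.2.2.2 ^ 2 = 1}

theorem coe_normOneCoords : (normOneCoords : Set (ℤ × ℤ × ℤ × ℤ)) = {v | normForm v = 1} := by
  ext ⟨a, m, n, p⟩
  simp only [normOneCoords, Finset.coe_filter, Finset.mem_product, Finset.mem_Icc,
    Set.mem_ofPred_eq, normForm, and_iff_right_iff_imp]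
  intro h
  have hsum : a ^ 2 + (a + 2 * m) ^ 2 + (a + 2 * n) ^ 2 + (a + 2 * p) ^ 2 = 2 ^ 2 := by
    linear_combination 4 * h
  have ha := abs_le.1 (abs_le_of_sq_le_sq (a := a) (b := 2) (by nlinarith) (by norm_num))
  have hm := abs_le.1 (abs_le_of_sq_le_sq (a := a + 2 * m) (b := 2) (by nlinarith) (by norm_num))
  have hn := abs_le.1 (abs_le_of_sq_le_sq (a := a + 2 * n) (b := 2) (by nlinarith) (by norm_num))
  have hp := abs_le.1 (abs_le_of_sq_le_sq (a := a + 2 * p) (b := 2) (by nlinarith) (by norm_num))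
  omega

theorem card_normOneCoords : normOneCoords.card = 24 := by
  decide +kernel

end HurwitzOrder

/-- The unit group of the Hurwitz order (the binary tetrahedral group) has order `24`. -/
theorem card_units_hurwitzOrder : Nat.card (↥HurwitzOrder)ˣ = 24 := by
  have hinj : Function.Injective (fun u : (↥HurwitzOrder)ˣ ↦ ((u : HurwitzOrder) : ℍ[ℚ])) :=
    Subtype.val_injective.comp Units.val_injective
  rw [← Nat.card_range_of_injective hinj, HurwitzOrder.range_units_val,
    Nat.card_coe_set_eq, Set.ncard_image_of_injective _ HurwitzOrder.ofCoords_injective,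
    ← HurwitzOrder.coe_normOneCoords, Set.ncard_coe_finset, HurwitzOrder.card_normOneCoords]
end
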